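/- arXiv:1503.03923 — 4 statements merged into one kernel-verified Lean document; each statement's English description precedes it below -/
import Mathlib

section
/- Interpolation bound between the diluted and SK constrained free energies: there exist finite constants A₁, A₂, independent of n, β and γ, such that for every even n ≥ 2, every β ∈ ℝ and every γ > 0, |φ^D_n(β/√(2γ), γ) − φ^SK_n(β)| ≤ A₁·|β|³/√γ + A₂·β⁴/γ. -/
open MeasureTheory Filter Finset

/-- The real value (±1) of a Boolean spin. -/
noncomputable def spin (b : Bool) : ℝ := if b then 1 else -1

/-- The Sherrington–Kirkpatrick Hamiltonian
`H^SK_n(σ) = -(2n)^{-1/2} Σ_{i,j} J_{ij} σ_i σ_j`. -/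
noncomputable def HSK (n : ℕ) (J : Fin n × Fin n → ℝ) (σ : Fin n → Bool) : ℝ :=
  -(Real.sqrt (2 * n))⁻¹ * ∑ p : Fin n × Fin n, J p * spin (σ p.1) * spin (σ p.2)

/-- The law of the i.i.d. standard Gaussian couplings `(J_{ij})`. -/
noncomputable def skMeasure (n : ℕ) : Measure ((Fin n × Fin n) → ℝ) :=
  Measure.pi fun _ => ProbabilityTheory.gaussianReal 0 1

/-- The law of the i.i.d. Poisson(γ/n) multiplicities `(z_{ij})_{1≤i,j≤n}`. -/
noncomputable def poissonProd (n : ℕ) (γ : ℝ) : Measure ((Fin n × Fin n) → ℕ) :=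
  Measure.pi fun _ => ProbabilityTheory.poissonMeasure (Real.toNNReal (γ / n))

/-- `σ ∈ Ω_n`: the spin configuration is balanced (zero magnetization). -/
def balanced {n : ℕ} (σ : Fin n → Bool) : Prop :=
  2 * (Finset.univ.filter fun i => σ i = true).card = n

open Classical in
/-- The finite set `Ω_n` of balanced configurations. -/
noncomputable def balancedFinset (n : ℕ) : Finset (Fin n → Bool) :=
  Finset.univ.filter fun σ => balanced σ

/-- The diluted Ising Hamiltonian `−Σ_{i,j} z_{ij} σ_i σ_j`. -/
noncomputable def HD {n : ℕ} (z : Fin n × Fin n → ℕ) (σ : Fin n → Bool) : ℝ :=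
  -∑ p : Fin n × Fin n, (z p : ℝ) * spin (σ p.1) * spin (σ p.2)

/-- The constrained SK free energy density
`φ^SK_n(β) = n⁻¹ E[log Σ_{σ∈Ω_n} e^{−β H^SK_n(σ)}]`. -/
noncomputable def phiSK (n : ℕ) (β : ℝ) : ℝ :=
  (n : ℝ)⁻¹ * ∫ J, Real.log (∑ σ ∈ balancedFinset n, Real.exp (-β * HSK n J σ))
    ∂(skMeasure n)

/-- The constrained diluted free energy density
`φ^D_n(β,γ) = n⁻¹ E[log Σ_{σ∈Ω_n} e^{−β H^D_{n,γ}(σ)}]`. -/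
noncomputable def phiD (n : ℕ) (β γ : ℝ) : ℝ :=
  (n : ℝ)⁻¹ * ∫ z, Real.log (∑ σ ∈ balancedFinset n, Real.exp (-β * HD z σ))
    ∂(poissonProd n γ)

/-- The constrained SK ground-state energy density
`e^SK_n = n⁻¹ E[min_{σ∈Ω_n} H^SK_n(σ)]`. -/
noncomputable def eSK (n : ℕ) : ℝ :=
  (n : ℝ)⁻¹ * ∫ J, sInf {x : ℝ | ∃ σ : Fin n → Bool, balanced σ ∧ HSK n J σ = x}
    ∂(skMeasure n)

/-- The constrained diluted ground-state energy density
`e^D_n(γ) = n⁻¹ E[min_{σ∈Ω_n} H^D_{n,γ}(σ)]`. -/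
noncomputable def eD (n : ℕ) (γ : ℝ) : ℝ :=
  (n : ℝ)⁻¹ * ∫ z, sInf {x : ℝ | ∃ σ : Fin n → Bool, balanced σ ∧ HD z σ = x}
    ∂(poissonProd n γ)

/-- The constrained diluted maximal energy density
`ê^D_n(γ) = n⁻¹ E[max_{σ∈Ω_n} H^D_{n,γ}(σ)]`. -/
noncomputable def eHatD (n : ℕ) (γ : ℝ) : ℝ :=
  (n : ℝ)⁻¹ * ∫ z, sSup {x : ℝ | ∃ σ : Fin n → Bool, balanced σ ∧ HD z σ = x}
    ∂(poissonProd n γ)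


lemma taylor3_aux (f f1 f2 f3 : ℝ → ℝ) (M : ℝ)
    (h0 : ∀ x, HasDerivAt f (f1 x) x) (h1 : ∀ x, HasDerivAt f1 (f2 x) x)
    (h2 : ∀ x, HasDerivAt f2 (f3 x) x) (h3 : ∀ x, |f3 x| ≤ M) (x y : ℝ) :
    |f (x + y) - f x - f1 x * y - f2 x * y ^ 2 / 2| ≤ M * |y| ^ 3 := by
  have hM : 0 ≤ M := (abs_nonneg _).trans (h3 0)
  have key : ∀ (g g' : ℝ → ℝ) (C : ℝ), (∀ t, HasDerivAt g (g' t) t) →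
      g 0 = 0 → (∀ t, |t| ≤ |y| → |g' t| ≤ C) → ∀ t, |t| ≤ |y| → |g t| ≤ C * |y| := by
    intro g g' C hg hg0 hC t ht
    have hCn : 0 ≤ C := (abs_nonneg _).trans (hC t ht)
    have := Convex.norm_image_sub_le_of_norm_hasDerivWithin_le (f := g) (f' := g') (C := C)
      (s := Set.Icc (-|y|) |y|) (x := 0) (y := t) (fun u _ => (hg u).hasDerivWithinAt)
      (fun u hu => by simpa using hC u (abs_le.2 hu)) (convex_Icc _ _)
      ⟨by simp, by simp⟩ (abs_le.1 ht)
    rw [hg0, sub_zero, sub_zero, Real.norm_eq_abs, Real.norm_eq_abs] at this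
    exact this.trans (mul_le_mul_of_nonneg_left ht hCn)
  have hs : ∀ (g g' : ℝ → ℝ) , (∀ t, HasDerivAt g (g' t) t) →
      ∀ t, HasDerivAt (fun t => g (x + t)) (g' (x + t)) t := by
    intro g g' hg t
    exact HasDerivAt.comp_const_add x t (hg (x + t))
  have e2 := key (fun t => f2 (x + t) - f2 x) (fun t => f3 (x + t)) M
    (fun t => (hs f2 f3 h2 t).sub_const _) (by simp) (fun t _ => h3 _)
  have e1 := key (fun t => f1 (x + t) - f1 x - f2 x * t) (fun t => f2 (x + t) - f2 x) (M * |y|)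
    (fun t => by
      have := ((hs f1 f2 h1 t).sub_const (f1 x)).sub ((hasDerivAt_id t).const_mul (f2 x))
      exact this.congr_deriv (by ring)) (by simp) e2
  have e0 := key (fun t => f (x + t) - f x - f1 x * t - f2 x * t ^ 2 / 2)
    (fun t => f1 (x + t) - f1 x - f2 x * t) (M * |y| * |y|)
    (fun t => by
      have := (((hs f f1 h0 t).sub_const (f x)).sub ((hasDerivAt_id t).const_mul (f1 x))).sub
        ((((hasDerivAt_id t).pow 2).const_mul (f2 x)).div_const 2)
      exact this.congr_deriv (by simp; ring)) (by simp) e1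
  have := e0 y le_rfl
  calc _ ≤ _ := this
    _ = _ := by ring

/-- Lipschitz with controlled second-order Taylor remainder. -/
def TNice (M L : ℝ) (f : ℝ → ℝ) : Prop :=
  (∀ x y, |f x - f y| ≤ L * |x - y|) ∧
  ∃ f1 f2 : ℝ → ℝ, ∀ x y, |f (x + y) - f x - f1 x * y - f2 x * y ^ 2 / 2| ≤ M * |y| ^ 3

lemma tnice_log (a b c : ℝ) (ha : 0 ≤ a) (hb : 0 ≤ b) (hab : 0 < a + b) :
    TNice (2 * |c| ^ 3) |c| (fun y => Real.log (a * Real.exp (c * y) + b * Real.exp (-(c * y)))) := by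
  set Z : ℝ → ℝ := fun y => a * Real.exp (c * y) + b * Real.exp (-(c * y)) with hZ
  set W : ℝ → ℝ := fun y => a * Real.exp (c * y) - b * Real.exp (-(c * y)) with hW
  have hZpos : ∀ y, 0 < Z y := by
    intro y
    rcases ha.lt_or_eq with h | h
    · exact add_pos_of_pos_of_nonneg (mul_pos h (Real.exp_pos _)) (mul_nonneg hb (Real.exp_pos _).le)
    · have : 0 < b := by linarith
      exact add_pos_of_nonneg_of_pos (mul_nonneg ha (Real.exp_pos _).le) (mul_pos this (Real.exp_pos _))
  have e1 : ∀ y, HasDerivAt (fun y => Real.exp (c * y)) (c * Real.exp (c * y)) y := by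
    intro y
    have := ((hasDerivAt_id y).const_mul c).exp
    simpa [mul_comm] using this
  have e2 : ∀ y, HasDerivAt (fun y => Real.exp (-(c * y))) (-c * Real.exp (-(c * y))) y := by
    intro y
    have := ((hasDerivAt_id y).const_mul c).neg.exp
    simpa [mul_comm] using this
  have dZ : ∀ y, HasDerivAt Z (c * W y) y := by
    intro y
    have := ((e1 y).const_mul a).add ((e2 y).const_mul b)
    exact this.congr_deriv (by simp only [hW]; ring)
  have dW : ∀ y, HasDerivAt W (c * Z y) y := by
    intro y
    have := ((e1 y).const_mul a).sub ((e2 y).const_mul b)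
    exact this.congr_deriv (by simp only [hZ]; ring)
  set u : ℝ → ℝ := fun y => W y / Z y with hu
  have hu1 : ∀ y, |u y| ≤ 1 := by
    intro y
    simp only [hu]
    rw [abs_div, abs_of_pos (hZpos y), div_le_one (hZpos y), abs_le]
    have h1 := mul_nonneg ha (Real.exp_pos (c * y)).le
    have h2 := mul_nonneg hb (Real.exp_pos (-(c * y))).le
    constructor <;> simp only [hW, hZ] <;> linarith
  have dlog : ∀ y, HasDerivAt (fun y => Real.log (Z y)) (c * u y) y := by
    intro y
    have := (dZ y).log (hZpos y).ne'
    exact this.congr_deriv (by simp only [hu]; ring)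
  have du : ∀ y, HasDerivAt u (c * (1 - u y ^ 2)) y := by
    intro y
    have := (dW y).div (dZ y) (hZpos y).ne'
    refine this.congr_deriv ?_
    have := (hZpos y).ne'
    simp only [hu]; field_simp
  refine ⟨?_, fun y => c * u y, fun y => c ^ 2 * (1 - u y ^ 2), ?_⟩
  · intro x y
    have := Convex.norm_image_sub_le_of_norm_hasDerivWithin_le (f := fun y => Real.log (Z y))
      (f' := fun y => c * u y) (C := |c|)
      (s := Set.univ) (x := y) (y := x) (fun u _ => (dlog u).hasDerivWithinAt)
      (fun v _ => by
        rw [Real.norm_eq_abs, abs_mul]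
        exact mul_le_of_le_one_right (abs_nonneg _) (hu1 v)) convex_univ trivial trivial
    simpa [Real.norm_eq_abs] using this
  · refine taylor3_aux _ _ _ (fun y => c ^ 3 * (-2 * u y * (1 - u y ^ 2))) _ dlog ?_ ?_ ?_
    · intro y
      have := (du y).const_mul c
      exact this.congr_deriv (by ring)
    · intro y
      have := (((du y).pow 2).const_sub 1).const_mul (c ^ 2)
      exact this.congr_deriv (by simp; ring)
    · intro y
      have h := hu1 y
      have h2 : u y ^ 2 ≤ 1 := by rw [← sq_abs]; exact pow_le_one₀ (abs_nonneg _) h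
      rw [abs_mul, abs_pow, abs_mul, abs_mul, mul_comm]
      gcongr
      rw [abs_of_nonneg (by linarith : 0 ≤ 1 - u y ^ 2)]
      have : 0 ≤ u y ^ 2 := sq_nonneg _
      have h0 := abs_nonneg (u y)
      norm_num
      nlinarith

lemma tnice_continuous {M L : ℝ} {f : ℝ → ℝ} (hf : TNice M L f) : Continuous f := by
  have : LipschitzWith (Real.toNNReal L) f := by
    apply LipschitzWith.of_dist_le_mul
    intro a b
    rw [Real.dist_eq, Real.dist_eq]
    exact (hf.1 a b).trans (mul_le_mul_of_nonneg_right (Real.le_coe_toNNReal L) (abs_nonneg _))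
  exact this.continuous

lemma tnice_integrable {M L : ℝ} {f : ℝ → ℝ} (hf : TNice M L f) (x : ℝ) (P : Measure ℝ)
    [IsProbabilityMeasure P] (hP : Integrable (fun y : ℝ => y) P) :
    Integrable (fun y => f (x + y)) P := by
  have hc := tnice_continuous hf
  refine Integrable.mono' ((integrable_const |f x|).add (hP.abs.const_mul L))
    (by fun_prop) (ae_of_all _ fun y => ?_)
  have := hf.1 (x + y) x
  rw [add_sub_cancel_left] at this
  have h2 := abs_sub_abs_le_abs_sub (f (x + y)) (f x)
  simp only [Real.norm_eq_abs, Pi.add_apply]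
  linarith

/-- third-order comparison for two measures with matching first two moments -/
lemma tnice_compare_one {M L : ℝ} {f : ℝ → ℝ} (hf : TNice M L f) (P : Measure ℝ)
    [IsProbabilityMeasure P] (hP1 : Integrable (fun y : ℝ => y) P)
    (hP2 : Integrable (fun y : ℝ => y ^ 2) P) (hP3 : Integrable (fun y : ℝ => |y| ^ 3) P)
    (m : ∫ y, y ∂P = 0) (f1 f2 : ℝ → ℝ)
    (hT : ∀ x y, |f (x + y) - f x - f1 x * y - f2 x * y ^ 2 / 2| ≤ M * |y| ^ 3) (x : ℝ) :
    |∫ y, f (x + y) ∂P - (f x + f2 x / 2 * ∫ y, y ^ 2 ∂P)| ≤ M * ∫ y, |y| ^ 3 ∂P := by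
  have hi := tnice_integrable hf x P hP1
  have h0 : ∫ y, (f (x + y) - f x - f1 x * y - f2 x / 2 * y ^ 2) ∂P
      = ∫ y, f (x + y) ∂P - (f x + f2 x / 2 * ∫ y, y ^ 2 ∂P) := by
    have i1 : Integrable (fun y => f (x + y) - f x) P := hi.sub (integrable_const _)
    have i2 : Integrable (fun y => f (x + y) - f x - f1 x * y) P := i1.sub (hP1.const_mul _)
    rw [integral_sub i2 (hP2.const_mul _), integral_sub i1 (hP1.const_mul _),
      integral_sub hi (integrable_const _), integral_const_mul, integral_const_mul, m]
    simp; ring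
  rw [← h0, ← integral_const_mul]
  refine (abs_integral_le_integral_abs).trans (integral_mono_of_nonneg (ae_of_all _ fun _ => abs_nonneg _)
    (hP3.const_mul _) (ae_of_all _ fun y => ?_))
  have := hT x y
  simp only
  rwa [show f2 x / 2 * y ^ 2 = f2 x * y ^ 2 / 2 by ring]

def TClose (f : ℝ → ℝ) (D : ℝ) (P G : Measure ℝ) : Prop :=
  ∀ x, |∫ y, f (x + y) ∂P - ∫ y, f (x + y) ∂G| ≤ D

lemma tclose_of_moments {M L : ℝ} {f : ℝ → ℝ} (hf : TNice M L f) (P G : Measure ℝ)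
    [IsProbabilityMeasure P] (hP1 : Integrable (fun y : ℝ => y) P)
    (hP2 : Integrable (fun y : ℝ => y ^ 2) P) (hP3 : Integrable (fun y : ℝ => |y| ^ 3) P)
    (mP : ∫ y, y ∂P = 0)
    [IsProbabilityMeasure G] (hG1 : Integrable (fun y : ℝ => y) G)
    (hG2 : Integrable (fun y : ℝ => y ^ 2) G) (hG3 : Integrable (fun y : ℝ => |y| ^ 3) G)
    (mG : ∫ y, y ∂G = 0) (hv : ∫ y, y ^ 2 ∂P = ∫ y, y ^ 2 ∂G) :
    TClose f (M * (∫ y, |y| ^ 3 ∂P + ∫ y, |y| ^ 3 ∂G)) P G := by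
  intro x
  obtain ⟨f1, f2, hT⟩ := hf.2
  have hp := tnice_compare_one hf P hP1 hP2 hP3 mP f1 f2 hT x
  have hg := tnice_compare_one hf G hG1 hG2 hG3 mG f1 f2 hT x
  rw [hv] at hp
  rw [abs_le] at *
  constructor <;> linarith [hp.1, hp.2, hg.1, hg.2]

lemma integral_conv_aux {M L : ℝ} {f : ℝ → ℝ} (hf : TNice M L f) (P Q : Measure ℝ)
    [IsProbabilityMeasure P] [IsProbabilityMeasure Q] (hP : Integrable (fun y : ℝ => y) P)
    (hQ : Integrable (fun y : ℝ => y) Q) (x : ℝ) :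
    Integrable (fun p : ℝ × ℝ => f (x + (p.1 + p.2))) (P.prod Q) ∧
    ∫ y, f (x + y) ∂(P.conv Q) = ∫ p, f (x + (p.1 + p.2)) ∂(P.prod Q) := by
  have hc := tnice_continuous hf
  constructor
  · have h1 : Integrable (fun p : ℝ × ℝ => p.1) (P.prod Q) := hP.comp_fst Q
    have h2 : Integrable (fun p : ℝ × ℝ => p.2) (P.prod Q) := hQ.comp_snd P
    have h := (h1.add h2)
    have h' : Integrable (fun y : ℝ => y) ((P.prod Q).map (fun p => p.1 + p.2)) := by
      rw [integrable_map_measure (by fun_prop) (by fun_prop)]; exact h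
    have : IsProbabilityMeasure ((P.prod Q).map (fun p : ℝ × ℝ => p.1 + p.2)) :=
      Measure.isProbabilityMeasure_map (by fun_prop)
    have := tnice_integrable hf x _ h'
    rw [integrable_map_measure (by fun_prop) (by fun_prop)] at this
    exact this
  · rw [Measure.conv, integral_map (by fun_prop) (by fun_prop)]

lemma tclose_conv {M L : ℝ} {f : ℝ → ℝ} (hf : TNice M L f) (P P' G G' : Measure ℝ)
    [IsProbabilityMeasure P] [IsProbabilityMeasure P'] [IsProbabilityMeasure G]
    [IsProbabilityMeasure G'] (hP : Integrable (fun y : ℝ => y) P)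
    (hP' : Integrable (fun y : ℝ => y) P') (hG : Integrable (fun y : ℝ => y) G)
    (hG' : Integrable (fun y : ℝ => y) G') {D D' : ℝ} (h : TClose f D P G)
    (h' : TClose f D' P' G') : TClose f (D + D') (P.conv P') (G.conv G') := by
  intro x
  have a1 : |∫ y, f (x + y) ∂(P.conv P') - ∫ y, f (x + y) ∂(P.conv G')| ≤ D' := by
    obtain ⟨i1, e1⟩ := integral_conv_aux hf P P' hP hP' x
    obtain ⟨i2, e2⟩ := integral_conv_aux hf P G' hP hG' x
    rw [e1, e2, integral_prod _ i1, integral_prod _ i2,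
      ← integral_sub i1.integral_prod_left i2.integral_prod_left]
    rw [← Real.norm_eq_abs]
    refine (norm_integral_le_of_norm_le_const (μ := P) (C := D') (ae_of_all _ fun y => ?_)).trans ?_
    · have := h' (x + y)
      simpa [add_assoc] using this
    · simp
  have a2 : |∫ y, f (x + y) ∂(P.conv G') - ∫ y, f (x + y) ∂(G.conv G')| ≤ D := by
    obtain ⟨i1, e1⟩ := integral_conv_aux hf P G' hP hG' x
    obtain ⟨i2, e2⟩ := integral_conv_aux hf G G' hG hG' x
    rw [e1, e2, integral_prod_symm _ i1, integral_prod_symm _ i2,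
      ← integral_sub i1.integral_prod_right i2.integral_prod_right]
    rw [← Real.norm_eq_abs]
    refine (norm_integral_le_of_norm_le_const (μ := G') (C := D) (ae_of_all _ fun y => ?_)).trans ?_
    · have := h (x + y)
      simpa [add_assoc, add_comm y] using this
    · simp
  have := abs_sub_le (∫ y, f (x + y) ∂(P.conv P')) (∫ y, f (x + y) ∂(P.conv G'))
    (∫ y, f (x + y) ∂(G.conv G'))
  linarith

section PoissonPart
open ProbabilityTheory
open scoped NNReal Nat

lemma poisson_shift (r : ℝ≥0) (g : ℕ → ℝ)
    (hg : Integrable (fun k => g (k + 1)) (poissonMeasure r)) :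
    Integrable (fun k : ℕ => (k : ℝ) * g k) (poissonMeasure r) ∧
    ∫ k : ℕ, (k : ℝ) * g k ∂(poissonMeasure r) = r * ∫ k, g (k + 1) ∂(poissonMeasure r) := by
  have e : ∀ k : ℕ, Real.exp (-r) * (r : ℝ) ^ (k + 1) / ((k + 1)! : ℕ) * ((k + 1 : ℕ) : ℝ)
      = r * (Real.exp (-r) * (r : ℝ) ^ k / (k ! : ℕ)) := by
    intro k
    rw [Nat.factorial_succ]
    have h1 : ((k + 1 : ℕ) : ℝ) ≠ 0 := by positivity
    have h2 : ((k ! : ℕ) : ℝ) ≠ 0 := by positivity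
    push_cast at *
    field_simp
    ring
  have hI : Integrable (fun k : ℕ => (k : ℝ) * g k) (poissonMeasure r) := by
    rw [integrable_poissonMeasure_iff] at hg ⊢
    rw [← summable_nat_add_iff 1]
    refine (summable_congr fun k => ?_).2 (hg.mul_left (r : ℝ))
    rw [norm_mul, ← mul_assoc, ← mul_assoc, ← e k, Real.norm_of_nonneg (by positivity)]
  refine ⟨hI, ?_⟩
  have h1 := hasSum_integral_poissonMeasure hI
  have h2 := (hasSum_integral_poissonMeasure hg).mul_left (r : ℝ)
  rw [← hasSum_nat_add_iff' 1] at h1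
  simp only [smul_eq_mul, Finset.range_one, Finset.sum_singleton, Nat.cast_zero, zero_mul, mul_zero,
    sub_zero] at h1 h2
  have h3 : ∀ k : ℕ, Real.exp (-r) * (r : ℝ) ^ (k + 1) / ((k + 1)! : ℕ) * (((k + 1 : ℕ) : ℝ) * g (k + 1))
      = r * (Real.exp (-r) * (r : ℝ) ^ k / (k ! : ℕ) * g (k + 1)) := by
    intro k
    rw [← mul_assoc, ← mul_assoc, ← e k]
  simp only [h3] at h1
  exact h1.unique h2

lemma poisson_moments (r : ℝ≥0) :
    Integrable (fun k : ℕ => (k : ℝ)) (poissonMeasure r) ∧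
    Integrable (fun k : ℕ => (k : ℝ) ^ 2) (poissonMeasure r) ∧
    Integrable (fun k : ℕ => (k : ℝ) ^ 3) (poissonMeasure r) ∧
    ∫ k : ℕ, (k : ℝ) ∂(poissonMeasure r) = r ∧
    ∫ k : ℕ, (k : ℝ) ^ 2 ∂(poissonMeasure r) = r ^ 2 + r ∧
    ∫ k : ℕ, (k : ℝ) ^ 3 ∂(poissonMeasure r) = r ^ 3 + 3 * r ^ 2 + r := by
  obtain ⟨i1, e1⟩ := poisson_shift r (fun _ => 1) (integrable_const _)
  simp only [mul_one, integral_const, probReal_univ, smul_eq_mul] at i1 e1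
  have j2 : Integrable (fun k : ℕ => ((k : ℝ) + 1)) (poissonMeasure r) := i1.add (integrable_const _)
  obtain ⟨i2, e2⟩ := poisson_shift r (fun k => (k : ℝ)) (by simpa using j2)
  simp only [Nat.cast_add, Nat.cast_one] at e2
  rw [integral_add i1 (integrable_const _), e1] at e2
  simp only [integral_const, probReal_univ, smul_eq_mul, ← pow_two] at i2 e2
  have j3' : Integrable (fun k : ℕ => (2 * (k : ℝ) + 1)) (poissonMeasure r) :=
    (i1.const_mul 2).add (integrable_const _)
  have j3 : Integrable (fun k : ℕ => (k : ℝ) ^ 2 + (2 * (k : ℝ) + 1)) (poissonMeasure r) :=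
    i2.add j3'
  have ee : ∀ k : ℕ, (((k + 1 : ℕ) : ℝ)) ^ 2 = (k : ℝ) ^ 2 + (2 * (k : ℝ) + 1) := by
    intro k; push_cast; ring
  obtain ⟨i3, e3⟩ := poisson_shift r (fun k => (k : ℝ) ^ 2) (by simpa only [ee] using j3)
  simp only [ee] at e3
  rw [integral_add i2 j3',
    integral_add (i1.const_mul 2) (integrable_const _), integral_const_mul, e1, e2] at e3
  simp only [integral_const, probReal_univ, smul_eq_mul, mul_one] at e3
  have e4 : ∀ k : ℕ, (k : ℝ) * (k : ℝ) ^ 2 = (k : ℝ) ^ 3 := by intro k; ring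
  simp only [e4] at i3 e3
  refine ⟨i1, i2, i3, e1, by rw [e2]; ring, by rw [e3]; ring⟩

/-- centered Poisson law -/
noncomputable def poisC (r : ℝ≥0) : Measure ℝ := (poissonMeasure r).map (fun k : ℕ => (k : ℝ) - r)

instance (r : ℝ≥0) : IsProbabilityMeasure (poisC r) :=
  Measure.isProbabilityMeasure_map (Measurable.of_discrete.aemeasurable)

lemma poisC_conv (r s : ℝ≥0) : (poisC r).conv (poisC s) = poisC (r + s) := by
  unfold poisC
  rw [← poissonMeasure_conv_poissonMeasure, Measure.conv, Measure.conv,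
    Measure.map_prod_map _ _ Measurable.of_discrete Measurable.of_discrete,
    Measure.map_map (by fun_prop) Measurable.of_discrete,
    Measure.map_map Measurable.of_discrete Measurable.of_discrete]
  congr 1
  ext p
  simp
  ring

lemma poisC_moments (r : ℝ≥0) :
    Integrable (fun y : ℝ => y) (poisC r) ∧
    Integrable (fun y : ℝ => y ^ 2) (poisC r) ∧
    Integrable (fun y : ℝ => |y| ^ 3) (poisC r) ∧
    ∫ y, y ∂(poisC r) = 0 ∧ ∫ y, y ^ 2 ∂(poisC r) = r ∧
    (r ≤ 1 → ∫ y, |y| ^ 3 ∂(poisC r) ≤ 6 * r) := by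
  obtain ⟨i1, i2, i3, e1, e2, e3⟩ := poisson_moments r
  have am : AEMeasurable (fun k : ℕ => (k : ℝ) - r) (poissonMeasure r) :=
    Measurable.of_discrete.aemeasurable
  have q : ∀ k : ℕ, ((k : ℝ) - r) ^ 2 = (k : ℝ) ^ 2 - (2 * r * k - r ^ 2) := by intro k; ring
  have bd : ∀ k : ℕ, |(k : ℝ) - r| ^ 3 ≤ (k : ℝ) ^ 3 + r ^ 3 := by
    intro k
    have hr : (0 : ℝ) ≤ r := r.2
    have hk : (0 : ℝ) ≤ k := by positivity
    rcases le_total (r : ℝ) k with h | h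
    · rw [abs_of_nonneg (by linarith)]
      have : ((k : ℝ) - r) ^ 3 ≤ (k : ℝ) ^ 3 := by gcongr <;> linarith
      have := pow_nonneg hr 3
      linarith
    · rw [abs_of_nonpos (by linarith)]
      have : (-((k : ℝ) - r)) ^ 3 ≤ (r : ℝ) ^ 3 := by gcongr <;> linarith
      have := pow_nonneg hk 3
      linarith
  have j1 : Integrable (fun k : ℕ => (k : ℝ) - r) (poissonMeasure r) := i1.sub (integrable_const _)
  have j2' : Integrable (fun k : ℕ => 2 * (r : ℝ) * k - (r : ℝ) ^ 2) (poissonMeasure r) :=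
    (i1.const_mul _).sub (integrable_const _)
  have j2 : Integrable (fun k : ℕ => ((k : ℝ) - r) ^ 2) (poissonMeasure r) := by
    simp only [q]
    exact i2.sub j2'
  have j3' : Integrable (fun k : ℕ => (k : ℝ) ^ 3 + (r : ℝ) ^ 3) (poissonMeasure r) :=
    i3.add (integrable_const _)
  have j3 : Integrable (fun k : ℕ => |(k : ℝ) - r| ^ 3) (poissonMeasure r) := by
    refine j3'.mono' (Measurable.of_discrete.aestronglyMeasurable) (ae_of_all _ fun k => ?_)
    rw [Real.norm_of_nonneg (by positivity)]
    exact bd k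
  unfold poisC
  refine ⟨?_, ?_, ?_, ?_, ?_, ?_⟩
  · rw [integrable_map_measure (by fun_prop) am]; exact j1
  · rw [integrable_map_measure (by fun_prop) am]; exact j2
  · rw [integrable_map_measure (by fun_prop) am]; exact j3
  · rw [integral_map am (by fun_prop), integral_sub i1 (integrable_const _), e1]; simp
  · rw [integral_map am (by fun_prop)]
    simp only [q]
    rw [integral_sub i2 j2', integral_sub (i1.const_mul _) (integrable_const _),
      integral_const_mul, e1, e2]
    simp; ring
  · intro hr
    have hr1 : (r : ℝ) ≤ 1 := hr
    have hr0 : (0 : ℝ) ≤ r := r.2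
    rw [integral_map am (by fun_prop)]
    refine (integral_mono j3 j3' bd).trans ?_
    rw [integral_add i3 (integrable_const _), e3]
    simp
    have h2 : (r : ℝ) ^ 2 ≤ r := by nlinarith
    have h3 : (r : ℝ) ^ 3 ≤ r := by nlinarith [mul_nonneg hr0 hr0]
    linarith

/-- third absolute moment of the standard Gaussian -/
noncomputable def gm3 : ℝ := ∫ y, |y| ^ 3 ∂(gaussianReal 0 1)

lemma gm3_nonneg : 0 ≤ gm3 := integral_nonneg fun _ => by positivity

lemma gauss_moments (r : ℝ≥0) :
    Integrable (fun y : ℝ => y) (gaussianReal 0 r) ∧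
    Integrable (fun y : ℝ => y ^ 2) (gaussianReal 0 r) ∧
    Integrable (fun y : ℝ => |y| ^ 3) (gaussianReal 0 r) ∧
    ∫ y, y ∂(gaussianReal 0 r) = 0 ∧ ∫ y, y ^ 2 ∂(gaussianReal 0 r) = r ∧
    (r ≤ 1 → ∫ y, |y| ^ 3 ∂(gaussianReal 0 r) ≤ gm3 * r) := by
  have h1 : MemLp id 1 (gaussianReal 0 r) := by exact_mod_cast memLp_id_gaussianReal 1
  have h2 : MemLp id 2 (gaussianReal 0 r) := by exact_mod_cast memLp_id_gaussianReal 2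
  have h3 : MemLp id 3 (gaussianReal 0 r) := by exact_mod_cast memLp_id_gaussianReal 3
  refine ⟨memLp_one_iff_integrable.1 h1, h2.integrable_sq, ?_, integral_id_gaussianReal, ?_, ?_⟩
  · have := h3.integrable_norm_pow (p := 3) (by norm_num)
    simpa using this
  · have := variance_fun_id_gaussianReal (μ := 0) (v := r)
    rw [variance_eq_integral (by fun_prop), integral_id_gaussianReal] at this
    simpa using this
  · intro hr
    have hr1 : (r : ℝ) ≤ 1 := hr
    have hr0 : (0 : ℝ) ≤ r := r.2
    have hm : (gaussianReal 0 1).map (fun y => Real.sqrt r * y) = gaussianReal 0 r := by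
      rw [gaussianReal_map_const_mul]
      congr 1
      · simp
      · ext; simp
    rw [← hm, integral_map (by fun_prop) (by fun_prop)]
    simp only [abs_mul, mul_pow]
    rw [integral_const_mul, mul_comm]
    change gm3 * _ ≤ _
    refine mul_le_mul_of_nonneg_left ?_ gm3_nonneg
    rw [abs_of_nonneg (Real.sqrt_nonneg _)]
    have hs := Real.sq_sqrt hr0
    have hs1 : Real.sqrt r ≤ 1 := Real.sqrt_le_one.2 hr1
    have : Real.sqrt r ^ 3 = r * Real.sqrt r := by rw [pow_succ, hs]
    rw [this]
    exact mul_le_of_le_one_right hr0 hs1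

lemma tclose_nsmul {M L : ℝ} {f : ℝ → ℝ} (hf : TNice M L f) (r : ℝ≥0) (D : ℝ)
    (h : TClose f D (poisC r) (gaussianReal 0 r)) (N : ℕ) :
    TClose f ((N + 1 : ℕ) * D) (poisC ((N + 1 : ℕ) * r)) (gaussianReal 0 ((N + 1 : ℕ) * r)) := by
  induction N with
  | zero => simpa using h
  | succ N ih =>
    have := tclose_conv hf _ _ _ _ (poisC_moments _).1 (poisC_moments _).1 (gauss_moments _).1
      (gauss_moments _).1 ih h
    rw [poisC_conv, gaussianReal_conv_gaussianReal, add_zero] at this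
    convert this using 1
    · push_cast; ring
    · congr 1; push_cast; ring
    · congr 1; push_cast; ring

lemma tclose_main {M L : ℝ} (hM : 0 ≤ M) {f : ℝ → ℝ} (hf : TNice M L f) (r : ℝ≥0) :
    TClose f (M * (6 + gm3) * r) (poisC r) (gaussianReal 0 r) := by
  obtain ⟨N, hN⟩ := exists_nat_ge r
  have hN1 : ((N + 1 : ℕ) : ℝ≥0) ≠ 0 := by positivity
  set s : ℝ≥0 := r / (N + 1 : ℕ) with hs
  have hrs : ((N + 1 : ℕ) : ℝ≥0) * s = r := by rw [hs]; field_simp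
  have hs1 : s ≤ 1 := by
    rw [hs]
    apply div_le_one_of_le₀ _ (by positivity)
    push_cast
    exact hN.trans (by simp)
  obtain ⟨p1, p2, p3, p4, p5, p6⟩ := poisC_moments s
  obtain ⟨g1, g2, g3, g4, g5, g6⟩ := gauss_moments s
  have h0 := tclose_of_moments hf (poisC s) (gaussianReal 0 s) p1 p2 p3 p4 g1 g2 g3 g4 (p5.trans g5.symm)
  have h1 : TClose f (M * (6 + gm3) * s) (poisC s) (gaussianReal 0 s) := by
    intro x
    refine (h0 x).trans ?_
    rw [mul_assoc]
    refine mul_le_mul_of_nonneg_left ?_ hM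
    linarith [p6 hs1, g6 hs1]
  have h2 := tclose_nsmul hf s _ h1 N
  rw [hrs] at h2
  have : (M * (6 + gm3) * r) = ((N + 1 : ℕ) : ℝ) * (M * (6 + gm3) * s) := by
    rw [← hrs]; push_cast; ring
  rw [this]
  exact h2

end PoissonPart

section Lindeberg

variable {ι : Type*} [Fintype ι] [DecidableEq ι]

lemma pi_update_map (κ κ' : ι → Measure ℝ) [∀ j, IsProbabilityMeasure (κ j)]
    [∀ j, IsProbabilityMeasure (κ' j)] (i : ι) (h : ∀ j, j ≠ i → κ' j = κ j) :
    ((Measure.pi κ).prod (κ' i)).map (fun p : (ι → ℝ) × ℝ => Function.update p.1 i p.2)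
      = Measure.pi κ' := by
  have hm : Measurable (fun p : (ι → ℝ) × ℝ => Function.update p.1 i p.2) := by
    refine measurable_pi_lambda _ fun j => ?_
    by_cases hj : j = i
    · subst hj; simpa using measurable_snd
    · simp only [Function.update_of_ne hj]
      exact (measurable_pi_apply j).comp measurable_fst
  refine (Measure.pi_eq fun s hs => ?_).symm
  rw [Measure.map_apply hm (MeasurableSet.univ_pi hs)]
  have hpre : (fun p : (ι → ℝ) × ℝ => Function.update p.1 i p.2) ⁻¹' (Set.univ.pi s)
      = (Set.univ.pi (Function.update s i Set.univ)) ×ˢ (s i) := by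
    ext p
    simp only [Set.mem_preimage, Set.mem_pi, Set.mem_univ, true_imp_iff, Set.mem_prod]
    constructor
    · intro H
      refine ⟨fun j => ?_, by simpa using H i⟩
      by_cases hj : j = i
      · subst hj; simp
      · simpa [Function.update_of_ne hj] using H j
    · rintro ⟨H, H'⟩ j
      by_cases hj : j = i
      · subst hj; simpa using H'
      · simpa [Function.update_of_ne hj] using H j
  rw [hpre, Measure.prod_prod, Measure.pi_pi, ← Finset.prod_erase_mul _ _ (Finset.mem_univ i),
    ← Finset.prod_erase_mul _ _ (Finset.mem_univ i)]
  simp only [Function.update_self, measure_univ, mul_one]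
  congr 1
  refine Finset.prod_congr rfl fun j hj => ?_
  have hj' := Finset.ne_of_mem_erase hj
  rw [Function.update_of_ne hj', h j hj']

lemma lindeberg_integrable (F : (ι → ℝ) → ℝ) (hF : Continuous F) (A B : ℝ)
    (hB : ∀ x, |F x| ≤ A + B * ∑ i, |x i|) (κ : ι → Measure ℝ) [∀ j, IsProbabilityMeasure (κ j)]
    (hκ : ∀ j, Integrable (fun y : ℝ => y) (κ j)) : Integrable F (Measure.pi κ) := by
  have h1 : ∀ j, Integrable (fun x : ι → ℝ => |x j|) (Measure.pi κ) := by
    intro j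
    have := (measurePreserving_eval κ j).integrable_comp_of_integrable (hκ j)
    exact this.abs
  refine Integrable.mono' ((integrable_const A).add
    ((integrable_finsetSum Finset.univ fun j _ => h1 j).const_mul B))
    hF.aestronglyMeasurable (ae_of_all _ fun x => ?_)
  simpa using hB x

lemma lindeberg (F : (ι → ℝ) → ℝ) (hF : Continuous F) (A B ε : ℝ)
    (hB : ∀ x, |F x| ≤ A + B * ∑ i, |x i|) (μ ν : Measure ℝ) [IsProbabilityMeasure μ]
    [IsProbabilityMeasure ν] (hμ : Integrable (fun y : ℝ => y) μ)
    (hν : Integrable (fun y : ℝ => y) ν)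
    (hε : ∀ x i, |∫ y, F (Function.update x i y) ∂μ - ∫ y, F (Function.update x i y) ∂ν| ≤ ε) :
    |∫ x, F x ∂(Measure.pi fun _ : ι => μ) - ∫ x, F x ∂(Measure.pi fun _ : ι => ν)|
      ≤ Fintype.card ι * ε := by
  have pm : ∀ (S : Finset ι) (j : ι), IsProbabilityMeasure (if j ∈ S then μ else ν) := by
    intro S j; split_ifs <;> infer_instance
  have im : ∀ (S : Finset ι) (j : ι), Integrable (fun y : ℝ => y) (if j ∈ S then μ else ν) := by
    intro S j; split_ifs <;> assumption
  have key : ∀ (κ κ' : ι → Measure ℝ) [∀ j, IsProbabilityMeasure (κ j)]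
      [∀ j, IsProbabilityMeasure (κ' j)] (_ : ∀ j, Integrable (fun y : ℝ => y) (κ' j))
      (i : ι) (_ : ∀ j, j ≠ i → κ' j = κ j),
      Integrable (fun x => ∫ y, F (Function.update x i y) ∂(κ' i)) (Measure.pi κ) ∧
      ∫ x, F x ∂(Measure.pi κ') = ∫ x, ∫ y, F (Function.update x i y) ∂(κ' i) ∂(Measure.pi κ) := by
    intro κ κ' _ _ hκ' i h
    have hm : Measurable (fun p : (ι → ℝ) × ℝ => Function.update p.1 i p.2) := by
      refine measurable_pi_lambda _ fun j => ?_
      by_cases hj : j = i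
      · subst hj; simpa using measurable_snd
      · simp only [Function.update_of_ne hj]
        exact (measurable_pi_apply j).comp measurable_fst
    have hi := lindeberg_integrable F hF A B hB κ' hκ'
    rw [← pi_update_map κ κ' i h] at hi
    rw [integrable_map_measure hF.aestronglyMeasurable hm.aemeasurable] at hi
    refine ⟨hi.integral_prod_left, ?_⟩
    rw [← pi_update_map κ κ' i h, integral_map hm.aemeasurable hF.aestronglyMeasurable]
    exact integral_prod _ hi
  have main : ∀ S : Finset ι,
      |∫ x, F x ∂(Measure.pi fun j : ι => if j ∈ S then μ else ν)
        - ∫ x, F x ∂(Measure.pi fun _ : ι => ν)| ≤ S.card * ε := by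
    intro S
    induction S using Finset.induction_on with
    | empty => simp
    | insert i S hi ih =>
      have := pm S
      have := pm (insert i S)
      obtain ⟨a1, a2⟩ := key (fun j => if j ∈ S then μ else ν)
        (fun j => if j ∈ insert i S then μ else ν) (im (insert i S)) i
        (fun j hj => by simp [hj])
      obtain ⟨b1, b2⟩ := key (fun j => if j ∈ S then μ else ν)
        (fun j => if j ∈ S then μ else ν) (im S) i (fun j hj => rfl)
      simp only [Finset.mem_insert_self, if_true] at a1 a2
      simp only [hi, if_false] at b1 b2
      have c : |∫ x, F x ∂(Measure.pi fun j : ι => if j ∈ insert i S then μ else ν)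
          - ∫ x, F x ∂(Measure.pi fun j : ι => if j ∈ S then μ else ν)| ≤ ε := by
        rw [a2, b2, ← integral_sub a1 b1, ← Real.norm_eq_abs]
        refine (norm_integral_le_of_norm_le_const
          (μ := Measure.pi fun j : ι => if j ∈ S then μ else ν) (C := ε)
          (ae_of_all _ fun x => ?_)).trans ?_
        · exact hε x i
        · simp
      rw [Finset.card_insert_of_notMem hi]
      push_cast
      have := abs_sub_le (∫ x, F x ∂(Measure.pi fun j : ι => if j ∈ insert i S then μ else ν))
        (∫ x, F x ∂(Measure.pi fun j : ι => if j ∈ S then μ else ν))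
        (∫ x, F x ∂(Measure.pi fun _ : ι => ν))
      linarith
  simpa using main Finset.univ

variable {τ : Type*}

/-- log partition function -/
noncomputable def lpf (S : Finset τ) (t : ι → τ → ℝ) (c : ℝ) (x : ι → ℝ) : ℝ :=
  Real.log (∑ σ ∈ S, Real.exp (c * ∑ p, x p * t p σ))

lemma lpf_pos (S : Finset τ) (hS : S.Nonempty) (t : ι → τ → ℝ) (c : ℝ) (x : ι → ℝ) :
    0 < ∑ σ ∈ S, Real.exp (c * ∑ p, x p * t p σ) :=
  Finset.sum_pos (fun _ _ => Real.exp_pos _) hS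

lemma lpf_continuous (S : Finset τ) (hS : S.Nonempty) (t : ι → τ → ℝ) (c : ℝ) :
    Continuous (lpf S t c) := by
  unfold lpf
  refine Continuous.log (by fun_prop) fun x => (lpf_pos S hS t c x).ne'

lemma lpf_bound (S : Finset τ) (hS : S.Nonempty) (t : ι → τ → ℝ)
    (ht : ∀ p σ, t p σ = 1 ∨ t p σ = -1) (c : ℝ) (x : ι → ℝ) :
    |lpf S t c x| ≤ |Real.log S.card| + |c| * ∑ i, |x i| := by
  set B := |c| * ∑ i, |x i| with hBdef
  have hh : ∀ σ, |c * ∑ p, x p * t p σ| ≤ B := by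
    intro σ
    rw [abs_mul]
    refine mul_le_mul_of_nonneg_left ((Finset.abs_sum_le_sum_abs _ _).trans
      (Finset.sum_le_sum fun p _ => ?_)) (abs_nonneg _)
    rcases ht p σ with h | h <;> simp [h]
  have hc : (0 : ℝ) < S.card := by exact_mod_cast hS.card_pos
  have up : ∑ σ ∈ S, Real.exp (c * ∑ p, x p * t p σ) ≤ S.card * Real.exp B := by
    rw [← nsmul_eq_mul]
    exact Finset.sum_le_card_nsmul _ _ _ fun σ _ => Real.exp_le_exp.2 (abs_le.1 (hh σ)).2
  have lo : S.card * Real.exp (-B) ≤ ∑ σ ∈ S, Real.exp (c * ∑ p, x p * t p σ) := by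
    rw [← nsmul_eq_mul]
    exact Finset.card_nsmul_le_sum _ _ _ fun σ _ => Real.exp_le_exp.2 (abs_le.1 (hh σ)).1
  have l1 := Real.log_le_log (lpf_pos S hS t c x) up
  have l2 := Real.log_le_log (by positivity) lo
  rw [Real.log_mul hc.ne' (Real.exp_pos _).ne', Real.log_exp] at l1 l2
  unfold lpf
  rw [abs_le]
  constructor
  · linarith [neg_abs_le (Real.log S.card)]
  · linarith [le_abs_self (Real.log S.card)]

lemma lpf_update (S : Finset τ) (hS : S.Nonempty) (t : ι → τ → ℝ)
    (ht : ∀ p σ, t p σ = 1 ∨ t p σ = -1) (c : ℝ) (x : ι → ℝ) (i : ι) :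
    TNice (2 * |c| ^ 3) |c| (fun y => lpf S t c (Function.update x i y)) := by
  classical
  set w : τ → ℝ := fun σ => Real.exp (c * ∑ p ∈ Finset.univ.erase i, x p * t p σ) with hw
  have hwp : ∀ σ, 0 < w σ := fun σ => Real.exp_pos _
  set a : ℝ := ∑ σ ∈ S, if t i σ = 1 then w σ else 0 with ha
  set b : ℝ := ∑ σ ∈ S, if t i σ = 1 then 0 else w σ with hb
  have ha0 : 0 ≤ a := Finset.sum_nonneg fun σ _ => by
    split_ifs
    · exact (hwp σ).le
    · exact le_rfl
  have hb0 : 0 ≤ b := Finset.sum_nonneg fun σ _ => by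
    split_ifs
    · exact le_rfl
    · exact (hwp σ).le
  have hab : 0 < a + b := by
    rw [ha, hb, ← Finset.sum_add_distrib]
    refine Finset.sum_pos (fun σ _ => ?_) hS
    split_ifs
    · simpa using hwp σ
    · simpa using hwp σ
  have := tnice_log a b c ha0 hb0 hab
  have e : (fun y => lpf S t c (Function.update x i y))
      = fun y => Real.log (a * Real.exp (c * y) + b * Real.exp (-(c * y))) := by
    funext y
    unfold lpf
    congr 1
    rw [ha, hb, Finset.sum_mul, Finset.sum_mul, ← Finset.sum_add_distrib]
    refine Finset.sum_congr rfl fun σ _ => ?_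
    have hsum : ∑ p, Function.update x i y p * t p σ
        = ∑ p ∈ Finset.univ.erase i, x p * t p σ + y * t i σ := by
      rw [← Finset.sum_erase_add _ _ (Finset.mem_univ i), Function.update_self]
      congr 1
      refine Finset.sum_congr rfl fun p hp => ?_
      rw [Function.update_of_ne (Finset.ne_of_mem_erase hp)]
    rw [hsum, mul_add, Real.exp_add]
    change w σ * _ = _
    rcases ht i σ with h | h
    · simp [h]
    · have h1 : ¬ ((-1 : ℝ) = 1) := by norm_num
      simp [h, h1]
  rw [e]
  exact this

lemma lpf_compare (S : Finset τ) (hS : S.Nonempty) (t : ι → τ → ℝ)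
    (ht : ∀ p σ, t p σ = 1 ∨ t p σ = -1) (c : ℝ) (r : NNReal) :
    |∫ x, lpf S t c x ∂(Measure.pi fun _ : ι => poisC r)
      - ∫ x, lpf S t c x ∂(Measure.pi fun _ : ι => ProbabilityTheory.gaussianReal 0 r)|
      ≤ Fintype.card ι * (2 * |c| ^ 3 * (6 + gm3) * r) := by
  refine lindeberg _ (lpf_continuous S hS t c) _ _ _ (lpf_bound S hS t ht c) _ _
    (poisC_moments r).1 (gauss_moments r).1 fun x i => ?_
  have := tclose_main (by positivity) (lpf_update S hS t ht c x i) r 0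
  simpa using this

end Lindeberg

lemma spin_sq_sum {n : ℕ} (σ : Fin n → Bool) (h : σ ∈ balancedFinset n) :
    ∑ p : Fin n × Fin n, spin (σ p.1) * spin (σ p.2) = 0 := by
  have h0 : ∑ i, spin (σ i) = 0 := by
    have hb : 2 * (Finset.univ.filter fun i => σ i = true).card = n := by
      classical
      unfold balancedFinset at h
      simp only [Finset.mem_filter] at h
      exact h.2
    have : ∀ i, spin (σ i) = 2 * (if σ i = true then (1 : ℝ) else 0) - 1 := by
      intro i; unfold spin; split_ifs <;> norm_num
    simp only [this]
    rw [Finset.sum_sub_distrib, ← Finset.mul_sum, Finset.sum_boole]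
    have hb' : (2 : ℝ) * ((Finset.univ.filter fun i => σ i = true).card : ℝ) = n := by
      exact_mod_cast hb
    rw [hb']; simp
  rw [Fintype.sum_prod_type]
  simp only [← Finset.mul_sum, h0, mul_zero, Finset.sum_const_zero]

/-- the pair interaction sign -/
noncomputable def tpair {n : ℕ} (p : Fin n × Fin n) (σ : Fin n → Bool) : ℝ :=
  spin (σ p.1) * spin (σ p.2)

lemma tpair_sign {n : ℕ} (p : Fin n × Fin n) (σ : Fin n → Bool) :
    tpair p σ = 1 ∨ tpair p σ = -1 := by
  unfold tpair spin
  split_ifs <;> norm_num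

lemma phiD_eq (n : ℕ) (c γ : ℝ) :
    phiD n c γ = (n : ℝ)⁻¹ * ∫ x, lpf (balancedFinset n) tpair c x
      ∂(Measure.pi fun _ : Fin n × Fin n => poisC (Real.toNNReal (γ / n))) := by
  by_cases hS : (balancedFinset n).Nonempty
  swap
  · rw [Finset.not_nonempty_iff_eq_empty] at hS
    simp [phiD, lpf, hS]
  unfold phiD poissonProd
  congr 1
  set r := Real.toNNReal (γ / n)
  have hm : Measurable (fun k : ℕ => (k : ℝ) - r) := Measurable.of_discrete
  have hsf : ∀ _ : Fin n × Fin n,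
      SigmaFinite ((ProbabilityTheory.poissonMeasure r).map (fun k : ℕ => (k : ℝ) - r)) := by
    intro _
    change SigmaFinite (poisC r)
    infer_instance
  have hmap := Measure.pi_map_pi (ι := Fin n × Fin n) (X := fun _ => ℕ) (Y := fun _ => ℝ)
    (μ := fun _ => ProbabilityTheory.poissonMeasure r) (f := fun _ k => (k : ℝ) - r)
    (fun _ => hm.aemeasurable)
  change _ = Measure.pi (fun _ => poisC r) at hmap
  rw [← hmap, integral_map (by
    refine (measurable_pi_lambda _ fun p => ?_).aemeasurable
    exact hm.comp (measurable_pi_apply p)) (lpf_continuous _ hS _ _).aestronglyMeasurable]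
  refine integral_congr_ae (ae_of_all _ fun z => ?_)
  unfold lpf
  simp only
  congr 1
  refine Finset.sum_congr rfl fun σ hσ => ?_
  congr 1
  have := spin_sq_sum σ hσ
  unfold HD tpair
  simp only [sub_mul, Finset.sum_sub_distrib]
  rw [← Finset.mul_sum, this, mul_zero, sub_zero, neg_mul_neg]
  simp only [mul_assoc]

lemma phiSK_eq (n : ℕ) (hn : 2 ≤ n) (β γ : ℝ) (hγ : 0 < γ) :
    phiSK n β = (n : ℝ)⁻¹ * ∫ x, lpf (balancedFinset n) tpair (β / Real.sqrt (2 * γ)) x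
      ∂(Measure.pi fun _ : Fin n × Fin n =>
        ProbabilityTheory.gaussianReal 0 (Real.toNNReal (γ / n))) := by
  by_cases hS : (balancedFinset n).Nonempty
  swap
  · rw [Finset.not_nonempty_iff_eq_empty] at hS
    simp [phiSK, lpf, hS]
  have hn0 : (0 : ℝ) < n := by positivity
  unfold phiSK skMeasure
  congr 1
  set r := Real.toNNReal (γ / n) with hr
  have hrr : (r : ℝ) = γ / n := Real.coe_toNNReal _ (by positivity)
  have hg : (ProbabilityTheory.gaussianReal 0 1).map (fun y => Real.sqrt r * y)
      = ProbabilityTheory.gaussianReal 0 r := by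
    rw [ProbabilityTheory.gaussianReal_map_const_mul]
    congr 1
    · simp
    · ext; simp
  have hsf : ∀ _ : Fin n × Fin n,
      SigmaFinite ((ProbabilityTheory.gaussianReal 0 1).map (fun y => Real.sqrt r * y)) := by
    intro _
    rw [hg]
    infer_instance
  have hmap := Measure.pi_map_pi (ι := Fin n × Fin n) (X := fun _ => ℝ) (Y := fun _ => ℝ)
    (μ := fun _ => ProbabilityTheory.gaussianReal 0 1) (f := fun _ y => Real.sqrt r * y)
    (fun _ => by fun_prop)
  rw [hg] at hmap
  rw [← hmap, integral_map (by
    refine (measurable_pi_lambda _ fun p => ?_).aemeasurable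
    exact (measurable_pi_apply p).const_mul _) (lpf_continuous _ hS _ _).aestronglyMeasurable]
  refine integral_congr_ae (ae_of_all _ fun J => ?_)
  unfold lpf
  simp only
  congr 1
  refine Finset.sum_congr rfl fun σ hσ => ?_
  congr 1
  unfold HSK tpair
  have hcoef : β / Real.sqrt (2 * γ) * Real.sqrt r = β * (Real.sqrt (2 * n))⁻¹ := by
    rw [hrr, Real.sqrt_div hγ.le, Real.sqrt_mul (by norm_num), Real.sqrt_mul (by norm_num)]
    have h1 : Real.sqrt γ ≠ 0 := (Real.sqrt_pos.2 hγ).ne'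
    have h2 : Real.sqrt n ≠ 0 := (Real.sqrt_pos.2 hn0).ne'
    field_simp
  simp only [mul_assoc]
  rw [← Finset.mul_sum, ← mul_assoc (β / Real.sqrt (2 * γ)), hcoef]
  ring

/-- **Interpolation bound between the diluted and SK constrained free
energies**: there are finite constants `A₁, A₂`, independent of `n`, `β`, `γ`,
such that for every even `n ≥ 2`, every `β ∈ ℝ` and every `γ > 0`,
`|φ^D_n(β/√(2γ), γ) − φ^SK_n(β)| ≤ A₁|β|³/√γ + A₂β⁴/γ`. -/
theorem interpolation_free_energy_bound :
    ∃ A₁ A₂ : ℝ, ∀ n : ℕ, Even n → 2 ≤ n → ∀ β γ : ℝ, 0 < γ →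
      |phiD n (β / Real.sqrt (2 * γ)) γ - phiSK n β|
        ≤ A₁ * |β| ^ 3 / Real.sqrt γ + A₂ * β ^ 4 / γ := by
  refine ⟨2 * (6 + gm3), 0, ?_⟩
  intro n _ hn β γ hγ
  have hn0 : (0 : ℝ) < n := by positivity
  have hsγ : 0 < Real.sqrt γ := Real.sqrt_pos.2 hγ
  have hK : 0 ≤ 6 + gm3 := by linarith [gm3_nonneg]
  rw [phiD_eq, phiSK_eq n hn β γ hγ]
  by_cases hS : (balancedFinset n).Nonempty
  swap
  · rw [Finset.not_nonempty_iff_eq_empty] at hS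
    simp [lpf, hS]
    positivity
  have h := lpf_compare (balancedFinset n) hS tpair tpair_sign (β / Real.sqrt (2 * γ))
    (Real.toNNReal (γ / n))
  rw [← mul_sub, abs_mul, abs_of_pos (inv_pos.2 hn0)]
  refine (mul_le_mul_of_nonneg_left h (inv_pos.2 hn0).le).trans ?_
  rw [Real.coe_toNNReal _ (by positivity), Fintype.card_prod, Fintype.card_fin, abs_div,
    abs_of_nonneg (Real.sqrt_nonneg _), div_pow]
  have hge : γ * Real.sqrt γ ≤ Real.sqrt (2 * γ) ^ 3 := by
    have h1 : γ * Real.sqrt γ = Real.sqrt γ ^ 3 := by rw [pow_succ, Real.sq_sqrt hγ.le]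
    rw [h1]
    gcongr
    linarith
  have e : (n : ℝ)⁻¹ * (((n * n : ℕ) : ℝ) * (2 * (|β| ^ 3 / Real.sqrt (2 * γ) ^ 3) * (6 + gm3) * (γ / n)))
      = 2 * (6 + gm3) * |β| ^ 3 * γ / Real.sqrt (2 * γ) ^ 3 := by
    push_cast
    field_simp
  rw [e]
  have e2 : 2 * (6 + gm3) * |β| ^ 3 / Real.sqrt γ + 0 * β ^ 4 / γ
      = 2 * (6 + gm3) * |β| ^ 3 * γ / (γ * Real.sqrt γ) := by
    field_simp
    ring
  rw [e2]
  gcongr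
end

section
/- Comparison of diluted and SK constrained ground-state energies: for every γ₀ > 0 there exists a finite constant A = A(γ₀) such that for all γ ≥ γ₀ and every even n ≥ 2, |e^D_n(γ)/√(2γ) − e^SK_n| ≤ A·γ^{−1/6} and |ê^D_n(γ)/√(2γ) + e^SK_n| ≤ A·γ^{−1/6}. -/
open MeasureTheory Filter Finset

lemma pois_int (r : NNReal) :
    Integrable (fun k : ℕ => (k : ℝ)) (ProbabilityTheory.poissonMeasure r) := by
  rw [ProbabilityTheory.integrable_poissonMeasure_iff]
  rw [← summable_nat_add_iff 1]
  have h := (ProbabilityTheory.hasSum_one_poissonMeasure r).summable.mul_left (r : ℝ)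
  refine h.congr fun k => ?_
  rw [Real.norm_of_nonneg (by positivity), Nat.factorial_succ]
  push_cast
  have : (k.factorial : ℝ) ≠ 0 := by positivity
  field_simp
  ring

lemma pois_stein (r : NNReal) (h : ℕ → ℝ) (C : ℝ) (hC : ∀ k, |h k| ≤ C) :
    ∫ k, (k : ℝ) * h k ∂(ProbabilityTheory.poissonMeasure r) =
      r * ∫ k, h (k + 1) ∂(ProbabilityTheory.poissonMeasure r) := by
  have hi : Integrable (fun k : ℕ => (k : ℝ) * h k) (ProbabilityTheory.poissonMeasure r) := by
    refine ((pois_int r).mul_const C).mono' (by fun_prop) (ae_of_all _ fun k => ?_)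
    rw [Real.norm_eq_abs, abs_mul, Nat.abs_cast]
    exact mul_le_mul_of_nonneg_left (hC k) (by positivity)
  have hs := (ProbabilityTheory.hasSum_integral_poissonMeasure hi)
  rw [← hs.tsum_eq, hs.summable.tsum_eq_zero_add, ProbabilityTheory.integral_poissonMeasure,
    ← tsum_mul_left]
  simp only [Nat.cast_zero, zero_mul, smul_zero, zero_add]
  refine tsum_congr fun k => ?_
  rw [Nat.factorial_succ]
  push_cast
  have : (k.factorial : ℝ) ≠ 0 := by positivity
  simp only [smul_eq_mul]
  field_simp
  ring

lemma gauss_id_int : Integrable (fun x : ℝ => x) (ProbabilityTheory.gaussianReal 0 1) :=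
  (ProbabilityTheory.memLp_id_gaussianReal' (μ := 0) (v := 1) 1 (by simp)).integrable le_rfl

lemma gauss_stein (h h' : ℝ → ℝ) (hd : ∀ x, HasDerivAt h (h' x) x) (hc : Continuous h')
    (C C' : ℝ) (hC : ∀ x, |h x| ≤ C) (hC' : ∀ x, |h' x| ≤ C') :
    ∫ x, x * h x ∂(ProbabilityTheory.gaussianReal 0 1) =
      ∫ x, h' x ∂(ProbabilityTheory.gaussianReal 0 1) := by
  have hcont : Continuous h := continuous_iff_continuousAt.2 fun x => (hd x).continuousAt
  set p := ProbabilityTheory.gaussianPDFReal 0 1 with hp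
  have hpd : ∀ x, HasDerivAt (fun x => - p x) (x * p x) x := by
    intro x
    have e : p = fun x => (Real.sqrt (2 * Real.pi * (1 : NNReal)))⁻¹ *
        Real.exp (-(x - 0) ^ 2 / (2 * (1 : NNReal))) := by
      rw [hp]; rfl
    rw [e]
    have h1 : HasDerivAt (fun x : ℝ => -(x - 0) ^ 2 / (2 * ((1 : NNReal) : ℝ))) (-x) x := by
      have := (((hasDerivAt_id x).sub_const 0).pow 2).neg.div_const (2 * ((1 : NNReal) : ℝ))
      refine this.congr_deriv ?_
      simp
      ring
    refine ((h1.exp.const_mul _).neg).congr_deriv ?_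
    ring
  have ip : Integrable p := ProbabilityTheory.integrable_gaussianPDFReal 0 1
  have ixp : Integrable (fun x => x * p x) := by
    have := gauss_id_int
    rw [ProbabilityTheory.gaussianReal_of_var_ne_zero _ one_ne_zero,
      ProbabilityTheory.gaussianPDF_def] at this
    rw [integrable_withDensity_iff (by fun_prop) (by simp)] at this
    refine this.congr (ae_of_all _ fun x => ?_)
    simp [ENNReal.toReal_ofReal (ProbabilityTheory.gaussianPDFReal_nonneg 0 1 x), hp]
  have key := integral_mul_deriv_eq_deriv_mul_of_integrable (u := h) (v := fun x => - p x)
    (u' := h') (v' := fun x => x * p x) (fun x _ => hd x) (fun x _ => hpd x)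
    (ixp.bdd_mul (c := C) hcont.aestronglyMeasurable (ae_of_all _ hC))
    (ip.neg.bdd_mul (c := C') hc.aestronglyMeasurable (ae_of_all _ hC'))
    (ip.neg.bdd_mul (c := C) hcont.aestronglyMeasurable (ae_of_all _ hC))
  rw [ProbabilityTheory.integral_gaussianReal_eq_integral_smul one_ne_zero,
    ProbabilityTheory.integral_gaussianReal_eq_integral_smul one_ne_zero]
  rw [← integral_neg] at key
  calc _ = ∫ x, h x * (x * p x) := integral_congr_ae (ae_of_all _ fun x => by simp [hp]; ring)
    _ = _ := key
    _ = _ := integral_congr_ae (ae_of_all _ fun x => by simp [hp]; ring)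

lemma oned (P N : Measure ℝ) [IsProbabilityMeasure P] [IsProbabilityMeasure N] (δ : ℝ) (hδ : δ ≠ 0)
    (hP : Integrable (fun x : ℝ => x) P) (hN : Integrable (fun x : ℝ => x) N)
    (hPs : ∀ (h : ℝ → ℝ) (C : ℝ), Continuous h → (∀ x, |h x| ≤ C) →
      ∫ x, x * h x ∂P = δ⁻¹ * ∫ x, (h (x + δ) - h x) ∂P)
    (hNs : ∀ (h h' : ℝ → ℝ) (C C' : ℝ), (∀ x, HasDerivAt h (h' x) x) → Continuous h' →
      (∀ x, |h x| ≤ C) → (∀ x, |h' x| ≤ C') → ∫ x, x * h x ∂N = ∫ x, h' x ∂N)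
    (f f1 f2 : ℝ → ℝ) (hf : ∀ x, HasDerivAt f (f1 x) x) (hf1 : ∀ x, HasDerivAt f1 (f2 x) x)
    (C1 C2 M : ℝ) (b1 : ∀ x, |f1 x| ≤ C1) (b2 : ∀ x, |f2 x| ≤ C2) (hM : 0 ≤ M)
    (lip : ∀ x y, |f2 x - f2 y| ≤ M * |x - y|) :
    |∫ x, f x ∂P - ∫ x, f x ∂N| ≤ 2 * M * |δ| := by
  have cf : Continuous f := continuous_iff_continuousAt.2 fun x => (hf x).continuousAt
  have cf1 : Continuous f1 := continuous_iff_continuousAt.2 fun x => (hf1 x).continuousAt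
  have cf2 : Continuous f2 := by
    have : LipschitzWith (Real.toNNReal M) f2 := by
      apply LipschitzWith.of_dist_le_mul
      intro x y
      rw [Real.dist_eq, Real.dist_eq, Real.coe_toNNReal _ hM]
      exact lip x y
    exact this.continuous
  have C1n : 0 ≤ C1 := (abs_nonneg _).trans (b1 0)
  have growth : ∀ x, |f x| ≤ |f 0| + C1 * |x| := by
    intro x
    have := Convex.norm_image_sub_le_of_norm_hasDerivWithin_le (f := f) (f' := f1) (C := C1)
      (s := Set.univ) (fun x _ => (hf x).hasDerivWithinAt) (fun x _ => b1 x) convex_univ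
      (Set.mem_univ 0) (Set.mem_univ x)
    simp only [Real.norm_eq_abs, sub_zero] at this
    have h2 := abs_sub_abs_le_abs_sub (f x) (f 0)
    linarith
  have taylor : ∀ x d, |f1 (x + d) - f1 x - d * f2 x| ≤ M * d ^ 2 := by
    intro x d
    have hd : ∀ y ∈ Set.uIcc x (x + d), HasDerivWithinAt (fun y => f1 y - y * f2 x)
        (f2 y - f2 x) (Set.uIcc x (x + d)) y := by
      intro y _
      refine (((hf1 y).sub ((hasDerivAt_id y).mul_const (f2 x))).congr_deriv ?_).hasDerivWithinAt
      simp
    have := Convex.norm_image_sub_le_of_norm_hasDerivWithin_le (C := M * |d|) hd (by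
      intro y hy
      refine (lip y x).trans (mul_le_mul_of_nonneg_left ?_ hM)
      have := Set.abs_sub_left_of_mem_uIcc hy
      simpa using this) (convex_uIcc _ _) Set.left_mem_uIcc Set.right_mem_uIcc
    simp only [Real.norm_eq_abs, add_sub_cancel_left] at this
    rw [mul_assoc, ← sq, sq_abs] at this
    convert this using 2
    ring
  let F' : ℝ → ℝ × ℝ → ℝ := fun θ q => (Real.cos θ * q.1 - Real.sin θ * q.2) *
    f1 (Real.sin θ * q.1 + Real.cos θ * q.2)
  have i1 : Integrable (fun q : ℝ × ℝ => q.1) (P.prod N) := hP.comp_fst N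
  have i2 : Integrable (fun q : ℝ × ℝ => q.2) (P.prod N) := hN.comp_snd P
  have hderiv : ∀ θ, Integrable (F' θ) (P.prod N) ∧
      HasDerivAt (fun θ => ∫ q, f (Real.sin θ * q.1 + Real.cos θ * q.2) ∂(P.prod N))
      (∫ q, F' θ q ∂(P.prod N)) θ := by
    intro θ
    refine hasDerivAt_integral_of_dominated_loc_of_deriv_le
      (F := fun θ (q : ℝ × ℝ) => f (Real.sin θ * q.1 + Real.cos θ * q.2)) (s := Set.univ)
      (bound := fun q => (|q.1| + |q.2|) * C1) univ_mem ?_ ?_ ?_ ?_ ?_ ?_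
    · exact Eventually.of_forall fun θ => (by fun_prop : Continuous _).aestronglyMeasurable
    · refine Integrable.mono' (g := fun q => |f 0| + C1 * (|q.1| + |q.2|))
        ((integrable_const _).add ((i1.abs.add i2.abs).const_mul C1))
        (by fun_prop : Continuous _).aestronglyMeasurable (ae_of_all _ fun q => ?_)
      refine (growth _).trans ?_
      gcongr
      refine (abs_add_le _ _).trans ?_
      rw [abs_mul, abs_mul]
      gcongr
      · exact mul_le_of_le_one_left (abs_nonneg _) (Real.abs_sin_le_one _)
      · exact mul_le_of_le_one_left (abs_nonneg _) (Real.abs_cos_le_one _)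
    · exact (by fun_prop : Continuous _).aestronglyMeasurable
    · refine ae_of_all _ fun q θ _ => ?_
      rw [Real.norm_eq_abs, abs_mul]
      refine mul_le_mul ?_ (b1 _) (abs_nonneg _) (by positivity)
      refine (abs_sub _ _).trans ?_
      rw [abs_mul, abs_mul]
      gcongr
      · exact mul_le_of_le_one_left (abs_nonneg _) (Real.abs_cos_le_one _)
      · exact mul_le_of_le_one_left (abs_nonneg _) (Real.abs_sin_le_one _)
    · exact (i1.abs.add i2.abs).mul_const C1
    · refine ae_of_all _ fun q θ _ => ?_
      have h1 : HasDerivAt (fun θ => Real.sin θ * q.1 + Real.cos θ * q.2)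
          (Real.cos θ * q.1 - Real.sin θ * q.2) θ := by
        refine (((Real.hasDerivAt_sin θ).mul_const q.1).add
          ((Real.hasDerivAt_cos θ).mul_const q.2)).congr_deriv (by ring)
      exact ((hf _).comp θ h1).congr_deriv (by simp only [F']; ring)
  have hbound : ∀ θ, |∫ q, F' θ q ∂(P.prod N)| ≤ M * |δ| := by
    intro θ
    set s := Real.sin θ
    set c := Real.cos θ
    have hs1 : |s| ≤ 1 := Real.abs_sin_le_one _
    have hc1 : |c| ≤ 1 := Real.abs_cos_le_one _
    have if1 : Integrable (fun q : ℝ × ℝ => q.1 * f1 (s * q.1 + c * q.2)) (P.prod N) :=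
      i1.mul_bdd (c := C1) (by fun_prop : Continuous _).aestronglyMeasurable
        (ae_of_all _ fun q => b1 _)
    have if2 : Integrable (fun q : ℝ × ℝ => q.2 * f1 (s * q.1 + c * q.2)) (P.prod N) :=
      i2.mul_bdd (c := C1) (by fun_prop : Continuous _).aestronglyMeasurable
        (ae_of_all _ fun q => b1 _)
    have bint : ∀ (g : ℝ × ℝ → ℝ) (C : ℝ), Continuous g → (∀ q, |g q| ≤ C) →
        Integrable g (P.prod N) := fun g C hg hC =>
      Integrable.of_bound hg.aestronglyMeasurable C (ae_of_all _ hC)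
    have if3 : Integrable (fun q : ℝ × ℝ => f2 (s * q.1 + c * q.2)) (P.prod N) :=
      bint _ C2 (by fun_prop) (fun q => b2 _)
    have if4 : Integrable (fun q : ℝ × ℝ => f1 (s * (q.1 + δ) + c * q.2) - f1 (s * q.1 + c * q.2))
        (P.prod N) :=
      (bint (fun q => f1 (s * (q.1 + δ) + c * q.2)) C1 (by fun_prop) (fun q => b1 _)).sub
       (bint (fun q => f1 (s * q.1 + c * q.2)) C1 (by fun_prop) (fun q => b1 _))
    have e1 : ∫ q, q.1 * f1 (s * q.1 + c * q.2) ∂(P.prod N) =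
        δ⁻¹ * ∫ q, (f1 (s * (q.1 + δ) + c * q.2) - f1 (s * q.1 + c * q.2)) ∂(P.prod N) := by
      rw [integral_prod_symm _ if1, integral_prod_symm _ if4, ← integral_const_mul]
      refine integral_congr_ae (ae_of_all _ fun y => ?_)
      exact hPs (fun x => f1 (s * x + c * y)) C1 (by fun_prop) (fun x => b1 _)
    have e2 : ∫ q, q.2 * f1 (s * q.1 + c * q.2) ∂(P.prod N) =
        c * ∫ q, f2 (s * q.1 + c * q.2) ∂(P.prod N) := by
      rw [integral_prod _ if2, integral_prod _ if3, ← integral_const_mul]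
      refine integral_congr_ae (ae_of_all _ fun x => ?_)
      simp only
      rw [← integral_const_mul]
      refine hNs (fun y => f1 (s * x + c * y)) (fun y => c * f2 (s * x + c * y)) C1 C2 ?_
        (by fun_prop) (fun y => b1 _) ?_
      · intro y
        have h1 : HasDerivAt (fun y => s * x + c * y) c y := by
          simpa using ((hasDerivAt_id y).const_mul c).const_add (s * x)
        exact ((hf1 _).comp y h1).congr_deriv (by ring)
      · intro y
        rw [abs_mul]
        exact (mul_le_of_le_one_left (abs_nonneg _) hc1).trans (b2 _)
    have e3 : ∫ q, F' θ q ∂(P.prod N) = c * δ⁻¹ *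
        ∫ q, ((f1 (s * (q.1 + δ) + c * q.2) - f1 (s * q.1 + c * q.2))
          - s * δ * f2 (s * q.1 + c * q.2)) ∂(P.prod N) := by
      rw [integral_sub if4 (if3.const_mul _), integral_const_mul]
      have : ∫ q, F' θ q ∂(P.prod N) = c * ∫ q, q.1 * f1 (s * q.1 + c * q.2) ∂(P.prod N)
          - s * ∫ q, q.2 * f1 (s * q.1 + c * q.2) ∂(P.prod N) := by
        rw [← integral_const_mul, ← integral_const_mul,
          ← integral_sub (if1.const_mul _) (if2.const_mul _)]
        refine integral_congr_ae (ae_of_all _ fun q => ?_)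
        simp only [F']
        ring
      rw [this, e1, e2]
      field_simp
    rw [e3, abs_mul, abs_mul, abs_inv]
    have e4 : |∫ q, ((f1 (s * (q.1 + δ) + c * q.2) - f1 (s * q.1 + c * q.2))
          - s * δ * f2 (s * q.1 + c * q.2)) ∂(P.prod N)| ≤ M * δ ^ 2 := by
      have := norm_integral_le_of_norm_le_const (μ := P.prod N) (C := M * δ ^ 2)
        (f := fun q => ((f1 (s * (q.1 + δ) + c * q.2) - f1 (s * q.1 + c * q.2))
          - s * δ * f2 (s * q.1 + c * q.2))) (ae_of_all _ fun q => by
          have := taylor (s * q.1 + c * q.2) (s * δ)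
          rw [Real.norm_eq_abs]
          have e : s * (q.1 + δ) + c * q.2 = s * q.1 + c * q.2 + s * δ := by ring
          rw [e]
          refine this.trans (mul_le_mul_of_nonneg_left ?_ hM)
          rw [mul_pow]
          have : s ^ 2 ≤ 1 := (sq_le_one_iff_abs_le_one s).2 hs1
          exact mul_le_of_le_one_left (sq_nonneg _) this)
      simpa using this
    have hd : 0 < |δ| := abs_pos.2 hδ
    calc |c| * |δ|⁻¹ * _ ≤ 1 * |δ|⁻¹ * (M * δ ^ 2) := by gcongr
      _ = M * |δ| := by rw [← sq_abs δ]; field_simp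
  have := Convex.norm_image_sub_le_of_norm_hasDerivWithin_le (C := M * |δ|)
      (s := Set.univ) (fun x _ => (hderiv x).2.hasDerivWithinAt) (fun x _ => hbound x) convex_univ
      (Set.mem_univ 0) (Set.mem_univ (Real.pi / 2))
  simp only [Real.sin_zero, Real.cos_zero, Real.sin_pi_div_two, Real.cos_pi_div_two, zero_mul,
    one_mul, zero_add, add_zero, sub_zero, integral_fun_fst, integral_fun_snd] at this
  simp only [Real.norm_eq_abs, probReal_univ, one_smul] at this
  refine this.trans ?_
  rw [abs_of_pos (a := Real.pi / 2) (by positivity)]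
  have hp : Real.pi / 2 ≤ 2 := by linarith [Real.pi_le_four]
  have : 0 ≤ M * |δ| := by positivity
  nlinarith

lemma lind_int {m : ℕ} (P N : Measure ℝ) [IsProbabilityMeasure P] [IsProbabilityMeasure N]
    (hP : Integrable (fun x : ℝ => x) P) (hN : Integrable (fun x : ℝ => x) N)
    (F : (Fin (m + 1) → ℝ) → ℝ) (hF : Measurable F) (a b : ℝ) (hb : 0 ≤ b)
    (hg : ∀ x, |F x| ≤ a + b * ∑ i, |x i|) :
    Integrable (fun q : ℝ × (Fin m → ℝ) => F (Fin.cons q.1 q.2))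
      (P.prod (Measure.pi fun _ => N)) := by
  have hm : Measurable fun q : ℝ × (Fin m → ℝ) => (Fin.cons q.1 q.2 : Fin (m + 1) → ℝ) := by
    refine measurable_pi_iff.2 fun i => ?_
    refine Fin.cases ?_ (fun j => ?_) i
    · simpa using measurable_fst
    · simp only [Fin.cons_succ]; exact (measurable_pi_apply j).comp measurable_snd
  have hi : ∀ j : Fin m, Integrable (fun y : Fin m → ℝ => |y j|) (Measure.pi fun _ => N) := by
    intro j
    exact ((measurePreserving_eval (fun _ : Fin m => N) j).integrable_comp_of_integrable hN).abs
  refine Integrable.mono' (g := fun q : ℝ × (Fin m → ℝ) => a + b * (|q.1| + ∑ i, |q.2 i|)) ?_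
    (hF.comp hm).aestronglyMeasurable (ae_of_all _ fun q => ?_)
  · refine (integrable_const _).add (Integrable.const_mul ?_ b)
    refine (hP.abs.comp_fst _).add ?_
    have : Integrable (fun y : Fin m → ℝ => ∑ i, |y i|) (Measure.pi fun _ => N) :=
      integrable_finsetSum _ fun i _ => hi i
    exact this.comp_snd P
  · have := hg (Fin.cons q.1 q.2)
    simpa [Fin.sum_univ_succ] using this

lemma lind_split {m : ℕ} (P : Measure ℝ) [IsProbabilityMeasure P]
    (F : (Fin (m + 1) → ℝ) → ℝ) :
    ∫ x, F x ∂(Measure.pi fun _ => P) =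
      ∫ q : ℝ × (Fin m → ℝ), F (Fin.cons q.1 q.2) ∂(P.prod (Measure.pi fun _ => P)) := by
  have h := (measurePreserving_piFinSuccAbove (fun _ : Fin (m + 1) => P) 0).symm
  rw [← h.integral_comp' (g := F)]
  refine integral_congr_ae (ae_of_all _ fun q => ?_)
  simp [MeasurableEquiv.piFinSuccAbove, Fin.insertNthEquiv]

lemma lind (P N : Measure ℝ) [IsProbabilityMeasure P] [IsProbabilityMeasure N]
    (hP : Integrable (fun x : ℝ => x) P) (hN : Integrable (fun x : ℝ => x) N) (δ : ℝ) (m : ℕ) :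
    ∀ (F : (Fin m → ℝ) → ℝ) (_ : Measurable F) (a b : ℝ) (_ : 0 ≤ b)
    (_ : ∀ x, |F x| ≤ a + b * ∑ i, |x i|)
    (_ : ∀ i x, |∫ t, F (Function.update x i t) ∂P - ∫ t, F (Function.update x i t) ∂N| ≤ δ),
    |∫ x, F x ∂(Measure.pi fun _ => P) - ∫ x, F x ∂(Measure.pi fun _ => N)| ≤ m * δ := by
  induction m with
  | zero =>
    intro F hF a b hb hg h
    have e : ∀ Q : Measure ℝ, IsProbabilityMeasure Q →
        ∫ x, F x ∂(Measure.pi fun _ : Fin 0 => Q) = F default := by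
      intro Q _
      rw [Measure.pi_of_empty (fun _ : Fin 0 => Q) default, integral_dirac]
    rw [e P inferInstance, e N inferInstance]
    simp
  | succ m ih =>
    intro F hF a b hb hg h
    rw [lind_split, lind_split]
    have iPP := lind_int P P hP hP F hF a b hb hg
    have iPN := lind_int P N hP hN F hF a b hb hg
    have iNN := lind_int N N hN hN F hF a b hb hg
    have h1 : |∫ q : ℝ × (Fin m → ℝ), F (Fin.cons q.1 q.2) ∂(P.prod (Measure.pi fun _ => P)) -
        ∫ q : ℝ × (Fin m → ℝ), F (Fin.cons q.1 q.2) ∂(P.prod (Measure.pi fun _ => N))| ≤ m * δ := by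
      rw [integral_prod _ iPP, integral_prod _ iPN,
        ← integral_sub iPP.integral_prod_left iPN.integral_prod_left]
      have := norm_integral_le_of_norm_le_const (μ := P) (C := m * δ)
        (f := fun x => ∫ y, F (Fin.cons x y) ∂(Measure.pi fun _ : Fin m => P) -
          ∫ y, F (Fin.cons x y) ∂(Measure.pi fun _ : Fin m => N)) (ae_of_all _ fun x => by
          refine ih (fun y => F (Fin.cons x y)) ?_ (a + b * |x|) b hb ?_ ?_
          · refine hF.comp (measurable_pi_iff.2 fun i => ?_)
            refine Fin.cases ?_ (fun j => ?_) i
            · simp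
            · simpa using measurable_pi_apply j
          · intro y
            have := hg (Fin.cons x y)
            simp only [Fin.sum_univ_succ, Fin.cons_zero, Fin.cons_succ] at this
            linarith
          · intro i y
            have := h i.succ (Fin.cons x y)
            simpa only [Fin.cons_update] using this)
      simpa using this
    have h2 : |∫ q : ℝ × (Fin m → ℝ), F (Fin.cons q.1 q.2) ∂(P.prod (Measure.pi fun _ => N)) -
        ∫ q : ℝ × (Fin m → ℝ), F (Fin.cons q.1 q.2) ∂(N.prod (Measure.pi fun _ => N))| ≤ δ := by
      rw [integral_prod_symm _ iPN, integral_prod_symm _ iNN,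
        ← integral_sub iPN.integral_prod_right iNN.integral_prod_right]
      have := norm_integral_le_of_norm_le_const (μ := (Measure.pi fun _ : Fin m => N)) (C := δ)
        (f := fun y => ∫ x, F (Fin.cons x y) ∂P - ∫ x, F (Fin.cons x y) ∂N)
        (ae_of_all _ fun y => by
          have := h 0 (Fin.cons 0 y)
          simpa only [Fin.update_cons_zero, Real.norm_eq_abs] using this)
      simpa using this
    have := abs_sub_le (∫ q : ℝ × (Fin m → ℝ), F (Fin.cons q.1 q.2) ∂(P.prod (Measure.pi fun _ => P)))
      (∫ q : ℝ × (Fin m → ℝ), F (Fin.cons q.1 q.2) ∂(P.prod (Measure.pi fun _ => N)))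
      (∫ q : ℝ × (Fin m → ℝ), F (Fin.cons q.1 q.2) ∂(N.prod (Measure.pi fun _ => N)))
    push_cast
    linarith

/-- version for arbitrary finite index types -/
lemma lind' {ι : Type*} [Fintype ι] [DecidableEq ι] (P N : Measure ℝ) [IsProbabilityMeasure P]
    [IsProbabilityMeasure N]
    (hP : Integrable (fun x : ℝ => x) P) (hN : Integrable (fun x : ℝ => x) N) (δ : ℝ)
    (F : (ι → ℝ) → ℝ) (hF : Measurable F) (a b : ℝ) (hb : 0 ≤ b)
    (hg : ∀ x, |F x| ≤ a + b * ∑ i, |x i|)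
    (h : ∀ i x, |∫ t, F (Function.update x i t) ∂P - ∫ t, F (Function.update x i t) ∂N| ≤ δ) :
    |∫ x, F x ∂(Measure.pi fun _ => P) - ∫ x, F x ∂(Measure.pi fun _ => N)|
      ≤ Fintype.card ι * δ := by
  let e := Fintype.equivFin ι
  have tr : ∀ Q : Measure ℝ, IsProbabilityMeasure Q →
      ∫ x, F x ∂(Measure.pi fun _ => Q) =
      ∫ y : Fin (Fintype.card ι) → ℝ, F (fun i => y (e i)) ∂(Measure.pi fun _ => Q) := by
    intro Q _
    have h := measurePreserving_piCongrLeft (fun _ : ι => Q) e.symm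
    rw [← h.integral_comp' (g := F)]
    refine integral_congr_ae (ae_of_all _ fun y => ?_)
    simp only
    congr 1
    ext i
    have := MeasurableEquiv.piCongrLeft_apply_apply (β := fun _ : ι => ℝ) e.symm y (e i)
    simpa using this
  rw [tr P inferInstance, tr N inferInstance]
  refine lind P N hP hN δ _ (fun y => F (fun i => y (e i))) (hF.comp (by fun_prop)) a b hb ?_ ?_
  · intro y
    have := hg (fun i => y (e i))
    rwa [e.sum_comp (fun j => |y j|)] at this
  · intro i y
    have := h (e.symm i) (fun i => y (e i))
    have e1 : ∀ t, (fun j => Function.update y i t (e j)) =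
        Function.update (fun i => y (e i)) (e.symm i) t := by
      intro t
      ext j
      by_cases hj : j = e.symm i
      · subst hj; simp
      · have : e j ≠ i := fun h => hj (by simp [← h])
        simp [hj, this]
    simp only [e1]
    exact this

/-- smoothed maximum -/
noncomputable def lse {ι κ : Type*} [Fintype ι] (S : Finset κ) (s : κ → ι → ℝ) (β c : ℝ)
    (x : ι → ℝ) : ℝ :=
  β⁻¹ * Real.log (∑ σ ∈ S, Real.exp (β * (c * ∑ p, x p * s σ p)))

lemma lse_oned {ι κ : Type*} [Fintype ι] [DecidableEq ι] (S : Finset κ) (hS : S.Nonempty)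
    (s : κ → ι → ℝ) (hs : ∀ σ p, s σ p = 1 ∨ s σ p = -1) (β c : ℝ) (hβ : 0 < β) (hc : 0 ≤ c)
    (i : ι) (x : ι → ℝ) :
    ∃ f1 f2 : ℝ → ℝ, (∀ t, HasDerivAt (fun t => lse S s β c (Function.update x i t)) (f1 t) t) ∧
      (∀ t, HasDerivAt f1 (f2 t) t) ∧ (∀ t, |f1 t| ≤ c) ∧ (∀ t, |f2 t| ≤ c * (β * c)) ∧
      ∀ t u, |f2 t - f2 u| ≤ 2 * c * (β * c) ^ 2 * |t - u| := by
  set k := β * c with hk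
  have hk0 : 0 ≤ k := by positivity
  let a : κ → ℝ := fun σ => Real.exp (β * (c * ∑ p ∈ univ.erase i, x p * s σ p))
  let Z : ℝ → ℝ := fun t => ∑ σ ∈ S, a σ * Real.exp (k * t * s σ i)
  let W : ℝ → ℝ := fun t => ∑ σ ∈ S, a σ * s σ i * Real.exp (k * t * s σ i)
  have hZ : ∀ t, 0 < Z t := fun t => Finset.sum_pos (fun σ _ => by positivity) hS
  have hsq : ∀ σ, s σ i * s σ i = 1 := fun σ => by
    rcases hs σ i with h | h <;> rw [h] <;> norm_num
  have hW : ∀ t, |W t| ≤ Z t := by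
    intro t
    refine (Finset.abs_sum_le_sum_abs _ _).trans (Finset.sum_le_sum fun σ _ => ?_)
    rw [abs_mul, abs_mul, abs_of_pos (Real.exp_pos _), abs_of_pos (Real.exp_pos _)]
    have : |s σ i| = 1 := by rcases hs σ i with h | h <;> rw [h] <;> norm_num
    rw [this, mul_one]
  have hE : ∀ σ t, HasDerivAt (fun t => Real.exp (k * t * s σ i))
      (Real.exp (k * t * s σ i) * (k * s σ i)) t := by
    intro σ t
    have : HasDerivAt (fun t => k * t * s σ i) (k * s σ i) t := by
      simpa using ((hasDerivAt_id t).const_mul k).mul_const (s σ i)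
    exact this.exp
  have dZ : ∀ t, HasDerivAt Z (k * W t) t := by
    intro t
    refine (HasDerivAt.fun_sum fun σ _ => (hE σ t).const_mul (a σ)).congr_deriv ?_
    rw [Finset.mul_sum]
    exact Finset.sum_congr rfl fun σ _ => by ring
  have dW : ∀ t, HasDerivAt W (k * Z t) t := by
    intro t
    refine (HasDerivAt.fun_sum fun σ _ => (hE σ t).const_mul (a σ * s σ i)).congr_deriv ?_
    rw [Finset.mul_sum]
    refine Finset.sum_congr rfl fun σ _ => ?_
    calc _ = a σ * Real.exp (k * t * s σ i) * k * (s σ i * s σ i) := by ring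
      _ = _ := by rw [hsq]; ring
  have hL : (fun t => lse S s β c (Function.update x i t)) = fun t => β⁻¹ * Real.log (Z t) := by
    ext t
    simp only [lse, Z, a]
    congr 2
    refine Finset.sum_congr rfl fun σ _ => ?_
    rw [← Real.exp_add]
    congr 1
    rw [← Finset.add_sum_erase _ _ (Finset.mem_univ i)]
    simp only [Function.update_self]
    have : ∑ p ∈ univ.erase i, Function.update x i t p * s σ p =
        ∑ p ∈ univ.erase i, x p * s σ p := by
      refine Finset.sum_congr rfl fun p hp => ?_
      rw [Function.update_of_ne (Finset.ne_of_mem_erase hp)]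
    rw [this, hk]
    ring
  let m : ℝ → ℝ := fun t => W t / Z t
  have hm1 : ∀ t, |m t| ≤ 1 := by
    intro t
    rw [abs_div, abs_of_pos (hZ t)]
    exact div_le_one_of_le₀ (hW t) (hZ t).le
  have dm : ∀ t, HasDerivAt m (k * (1 - m t ^ 2)) t := by
    intro t
    refine ((dW t).div (dZ t) (hZ t).ne').congr_deriv ?_
    have := (hZ t).ne'
    simp only [m]
    field_simp
  have hm2 : ∀ t, |1 - m t ^ 2| ≤ 1 := by
    intro t
    have h1 : m t ^ 2 ≤ 1 := (sq_le_one_iff_abs_le_one _).2 (hm1 t)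
    rw [abs_le]; constructor <;> nlinarith [sq_nonneg (m t)]
  have lm : ∀ t u, |m t - m u| ≤ k * |t - u| := by
    intro t u
    have := Convex.norm_image_sub_le_of_norm_hasDerivWithin_le (C := k)
      (s := Set.univ) (fun x _ => (dm x).hasDerivWithinAt) (fun x _ => by
        rw [Real.norm_eq_abs, abs_mul, abs_of_nonneg hk0]
        exact mul_le_of_le_one_right hk0 (hm2 x)) convex_univ
      (Set.mem_univ u) (Set.mem_univ t)
    simpa using this
  refine ⟨fun t => c * m t, fun t => c * (k * (1 - m t ^ 2)), ?_, ?_, ?_, ?_, ?_⟩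
  · intro t
    rw [hL]
    refine (((dZ t).log (hZ t).ne').const_mul β⁻¹).congr_deriv ?_
    simp only [m, hk]
    field_simp
  · intro t
    exact (dm t).const_mul c
  · intro t
    rw [abs_mul, abs_of_nonneg hc]
    exact mul_le_of_le_one_right hc (hm1 t)
  · intro t
    rw [abs_mul, abs_mul, abs_of_nonneg hc, abs_of_nonneg hk0]
    exact mul_le_mul_of_nonneg_left (mul_le_of_le_one_right hk0 (hm2 t)) hc
  · intro t u
    have e : c * (k * (1 - m t ^ 2)) - c * (k * (1 - m u ^ 2)) =
      -(c * k) * ((m t + m u) * (m t - m u)) := by ring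
    simp only
    rw [e, abs_mul, abs_neg, abs_of_nonneg (by positivity : 0 ≤ c * k), abs_mul]
    have h1 : |m t + m u| ≤ 2 := (abs_add_le _ _).trans (by linarith [hm1 t, hm1 u])
    calc c * k * (|m t + m u| * |m t - m u|) ≤ c * k * (2 * (k * |t - u|)) := by
          gcongr; exact lm t u
      _ = _ := by ring

lemma lse_bounds {ι κ : Type*} [Fintype ι] (S : Finset κ) (hS : S.Nonempty)
    (s : κ → ι → ℝ) (β c : ℝ) (hβ : 0 < β) (x : ι → ℝ) :
    S.sup' hS (fun σ => c * ∑ p, x p * s σ p) ≤ lse S s β c x ∧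
    lse S s β c x ≤ S.sup' hS (fun σ => c * ∑ p, x p * s σ p) + Real.log S.card / β := by
  constructor
  · refine Finset.sup'_le _ _ fun σ hσ => ?_
    rw [lse, le_inv_mul_iff₀ hβ, Real.le_log_iff_exp_le
      (Finset.sum_pos (fun σ _ => Real.exp_pos _) hS)]
    exact Finset.single_le_sum (f := fun σ => Real.exp (β * (c * ∑ p, x p * s σ p)))
      (fun σ _ => (Real.exp_pos _).le) hσ
  · set G := S.sup' hS (fun σ => c * ∑ p, x p * s σ p) with hG
    have h1 : ∑ σ ∈ S, Real.exp (β * (c * ∑ p, x p * s σ p)) ≤ S.card * Real.exp (β * G) := by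
      rw [← nsmul_eq_mul]
      refine Finset.sum_le_card_nsmul _ _ _ fun σ hσ => ?_
      refine Real.exp_le_exp.2 (mul_le_mul_of_nonneg_left ?_ hβ.le)
      exact Finset.le_sup' (fun σ => c * ∑ p, x p * s σ p) hσ
    have hc0 : (0 : ℝ) < S.card := by exact_mod_cast hS.card_pos
    have h2 := Real.log_le_log (Finset.sum_pos (fun σ _ => Real.exp_pos _) hS) h1
    rw [Real.log_mul hc0.ne' (Real.exp_pos _).ne', Real.log_exp] at h2
    rw [lse]
    calc β⁻¹ * _ ≤ β⁻¹ * (Real.log S.card + β * G) := by gcongr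
      _ = _ := by field_simp; ring

lemma sup_abs {ι κ : Type*} [Fintype ι] (S : Finset κ) (hS : S.Nonempty)
    (s : κ → ι → ℝ) (hs : ∀ σ p, s σ p = 1 ∨ s σ p = -1) (c : ℝ) (hc : 0 ≤ c) (x : ι → ℝ) :
    |S.sup' hS (fun σ => c * ∑ p, x p * s σ p)| ≤ c * ∑ p, |x p| := by
  obtain ⟨σ, -, h⟩ := Finset.exists_mem_eq_sup' hS (fun σ => c * ∑ p, x p * s σ p)
  rw [h, abs_mul, abs_of_nonneg hc]
  refine mul_le_mul_of_nonneg_left ((Finset.abs_sum_le_sum_abs _ _).trans ?_) hc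
  refine Finset.sum_le_sum fun p _ => ?_
  rw [abs_mul]
  have : |s σ p| = 1 := by rcases hs σ p with h | h <;> rw [h] <;> norm_num
  rw [this, mul_one]

lemma universal {ι κ : Type*} [Fintype ι] [DecidableEq ι] (S : Finset κ) (hS : S.Nonempty)
    (s : κ → ι → ℝ) (hs : ∀ σ p, s σ p = 1 ∨ s σ p = -1) (β c : ℝ) (hβ : 0 < β) (hc : 0 ≤ c)
    (P N : Measure ℝ) [IsProbabilityMeasure P] [IsProbabilityMeasure N] (δ : ℝ) (hδ : δ ≠ 0)
    (hP : Integrable (fun x : ℝ => x) P) (hN : Integrable (fun x : ℝ => x) N)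
    (hPs : ∀ (h : ℝ → ℝ) (C : ℝ), Continuous h → (∀ x, |h x| ≤ C) →
      ∫ x, x * h x ∂P = δ⁻¹ * ∫ x, (h (x + δ) - h x) ∂P)
    (hNs : ∀ (h h' : ℝ → ℝ) (C C' : ℝ), (∀ x, HasDerivAt h (h' x) x) → Continuous h' →
      (∀ x, |h x| ≤ C) → (∀ x, |h' x| ≤ C') → ∫ x, x * h x ∂N = ∫ x, h' x ∂N) :
    |∫ x, S.sup' hS (fun σ => c * ∑ p, x p * s σ p) ∂(Measure.pi fun _ : ι => P) -
      ∫ x, S.sup' hS (fun σ => c * ∑ p, x p * s σ p) ∂(Measure.pi fun _ : ι => N)| ≤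
      2 * (Real.log S.card / β) + Fintype.card ι * (2 * (2 * c * (β * c) ^ 2) * |δ|) := by
  set L := Real.log S.card / β with hL
  have hL0 : 0 ≤ L := div_nonneg (Real.log_natCast_nonneg _) hβ.le
  let G : (ι → ℝ) → ℝ := fun x => S.sup' hS (fun σ => c * ∑ p, x p * s σ p)
  have hGc : Continuous G := by
    refine Continuous.finset_sup'_apply hS fun σ _ => ?_
    fun_prop
  have hFc : Continuous (lse S s β c) := by
    unfold lse
    refine continuous_const.mul (Continuous.log (by fun_prop) fun x => ?_)
    exact (Finset.sum_pos (fun σ _ => Real.exp_pos _) hS).ne'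
  have hFG : ∀ x, |lse S s β c x - G x| ≤ L := by
    intro x
    have := lse_bounds S hS s β c hβ x
    rw [abs_le]
    constructor
    · linarith [this.1]
    · linarith [this.2]
  have hGg : ∀ x, |G x| ≤ c * ∑ p, |x p| := fun x => sup_abs S hS s hs c hc x
  have hFg : ∀ x, |lse S s β c x| ≤ L + c * ∑ p, |x p| := by
    intro x
    have := abs_sub_abs_le_abs_sub (lse S s β c x) (G x)
    linarith [hFG x, hGg x]
  have near : ∀ Q : Measure ℝ, IsProbabilityMeasure Q → Integrable (fun x : ℝ => x) Q →
      |∫ x, lse S s β c x ∂(Measure.pi fun _ : ι => Q) - ∫ x, G x ∂(Measure.pi fun _ : ι => Q)|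
        ≤ L := by
    intro Q _ hQ
    have hi : Integrable (fun y : ι → ℝ => ∑ i, |y i|) (Measure.pi fun _ => Q) :=
      integrable_finsetSum _ fun j _ =>
        ((measurePreserving_eval (fun _ : ι => Q) j).integrable_comp_of_integrable hQ).abs
    have iG : Integrable G (Measure.pi fun _ : ι => Q) :=
      (hi.const_mul c).mono' hGc.aestronglyMeasurable (ae_of_all _ hGg)
    have iF : Integrable (lse S s β c) (Measure.pi fun _ : ι => Q) :=
      ((integrable_const L).add (hi.const_mul c)).mono' hFc.aestronglyMeasurable (ae_of_all _ hFg)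
    rw [← integral_sub iF iG]
    have := norm_integral_le_of_norm_le_const (μ := (Measure.pi fun _ : ι => Q))
      (f := fun x => lse S s β c x - G x) (ae_of_all _ hFG)
    simpa using this
  have main := lind' P N hP hN (2 * (2 * c * (β * c) ^ 2) * |δ|) (lse S s β c) hFc.measurable L c hc
    hFg (by
      intro i x
      obtain ⟨f1, f2, h1, h2, h3, h4, h5⟩ := lse_oned S hS s hs β c hβ hc i x
      exact oned P N δ hδ hP hN hPs hNs _ f1 f2 h1 h2 _ _ _ h3 h4 (by positivity) h5)
  have n1 := abs_le.1 (near P inferInstance hP)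
  have n2 := abs_le.1 (near N inferInstance hN)
  have n3 := abs_le.1 main
  rw [abs_le]
  constructor <;> linarith [n1.1, n1.2, n2.1, n2.2, n3.1, n3.2]

/-- law of `δ (z - r)` -/
noncomputable def poisLaw (r : NNReal) (δ : ℝ) : Measure ℝ :=
  (ProbabilityTheory.poissonMeasure r).map fun k : ℕ => δ * ((k : ℝ) - r)

instance (r : NNReal) (δ : ℝ) : IsProbabilityMeasure (poisLaw r δ) :=
  Measure.isProbabilityMeasure_map (by fun_prop)

lemma poisLaw_int (r : NNReal) (δ : ℝ) : Integrable (fun x : ℝ => x) (poisLaw r δ) := by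
  rw [poisLaw, integrable_map_measure (by fun_prop) (by fun_prop)]
  exact ((pois_int r).sub (integrable_const _)).const_mul δ

lemma poisLaw_stein (r : NNReal) (δ : ℝ) (hδ : δ ≠ 0) (hr : δ ^ 2 * r = 1)
    (h : ℝ → ℝ) (C : ℝ) (hc : Continuous h) (hC : ∀ x, |h x| ≤ C) :
    ∫ x, x * h x ∂(poisLaw r δ) = δ⁻¹ * ∫ x, (h (x + δ) - h x) ∂(poisLaw r δ) := by
  rw [poisLaw, integral_map (by fun_prop) (by fun_prop), integral_map (by fun_prop) (by fun_prop)]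
  have b1 : ∀ g : ℕ → ℝ, (∀ k, |g k| ≤ C) → Integrable g (ProbabilityTheory.poissonMeasure r) :=
    fun g hg => Integrable.of_bound (by fun_prop) C (ae_of_all _ hg)
  have i1 := b1 (fun k => h (δ * ((k : ℝ) - r))) (fun k => hC _)
  have i2 := b1 (fun k => h (δ * ((k : ℝ) - r) + δ)) (fun k => hC _)
  have i3 : Integrable (fun k : ℕ => (k : ℝ) * h (δ * ((k : ℝ) - r)))
      (ProbabilityTheory.poissonMeasure r) :=
    (pois_int r).mul_bdd (c := C) (by fun_prop) (ae_of_all _ fun k => hC _)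
  have st := pois_stein r (fun k => h (δ * ((k : ℝ) - r))) C (fun k => hC _)
  have e1 : ∀ k : ℕ, δ * (((k + 1 : ℕ) : ℝ) - r) = δ * ((k : ℝ) - r) + δ := by
    intro k; push_cast; ring
  simp only [e1] at st
  rw [integral_sub i2 i1]
  have : ∫ k : ℕ, δ * ((k : ℝ) - r) * h (δ * ((k : ℝ) - r)) ∂(ProbabilityTheory.poissonMeasure r) =
      δ * ∫ k : ℕ, (k : ℝ) * h (δ * ((k : ℝ) - r)) ∂(ProbabilityTheory.poissonMeasure r) -
      δ * r * ∫ k : ℕ, h (δ * ((k : ℝ) - r)) ∂(ProbabilityTheory.poissonMeasure r) := by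
    rw [← integral_const_mul, ← integral_const_mul,
      ← integral_sub (i3.const_mul _) (i1.const_mul _)]
    exact integral_congr_ae (ae_of_all _ fun k => by ring)
  rw [this, st]
  have e2 : δ⁻¹ = δ * r := by
    have : δ * (δ * r) = 1 := by rw [← hr]; ring
    exact inv_eq_of_mul_eq_one_right this
  rw [e2]
  ring

lemma spin_cases (b : Bool) : spin b = 1 ∨ spin b = -1 := by
  cases b <;> simp [spin]

lemma balanced_sum {n : ℕ} (σ : Fin n → Bool) (h : balanced σ) :
    ∑ p : Fin n × Fin n, spin (σ p.1) * spin (σ p.2) = 0 := by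
  have h0 : ∑ i, spin (σ i) = 0 := by
    have e : ∀ i, spin (σ i) = 2 * (if σ i = true then (1 : ℝ) else 0) - 1 := by
      intro i; unfold spin; split_ifs <;> norm_num
    simp only [e]
    rw [Finset.sum_sub_distrib, ← Finset.mul_sum, Finset.sum_boole]
    unfold balanced at h
    have : (2 : ℝ) * ((Finset.univ.filter fun i => σ i = true).card : ℝ) = n := by exact_mod_cast h
    rw [this]
    simp
  rw [Fintype.sum_prod_type]
  simp only [← Finset.mul_sum, h0, mul_zero, Finset.sum_const_zero]

lemma balanced_nonempty {n : ℕ} (hn : Even n) : (balancedFinset n).Nonempty := by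
  obtain ⟨m, rfl⟩ := hn
  refine ⟨fun i => decide (i.val < m), ?_⟩
  have : (Finset.univ.filter fun i : Fin (m + m) => i.val < m).card = m := by
    rw [Fin.card_filter_val_lt]
    simp
  have hb : balanced (fun i : Fin (m + m) => decide (i.val < m)) := by
    simp only [balanced, decide_eq_true_eq]
    rw [this]; ring
  simpa [balancedFinset] using hb

lemma sSup_bal {n : ℕ} (hS : (balancedFinset n).Nonempty) (H : (Fin n → Bool) → ℝ) :
    sSup {x : ℝ | ∃ σ : Fin n → Bool, balanced σ ∧ H σ = x} = (balancedFinset n).sup' hS H := by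
  rw [Finset.sup'_eq_csSup_image]
  congr 1
  ext x
  simp [balancedFinset]

lemma sInf_bal {n : ℕ} (hS : (balancedFinset n).Nonempty) (H : (Fin n → Bool) → ℝ) :
    sInf {x : ℝ | ∃ σ : Fin n → Bool, balanced σ ∧ H σ = x} =
      -(balancedFinset n).sup' hS (fun σ => - H σ) := by
  rw [← sSup_bal hS, Real.sInf_def]
  congr 2
  ext x
  simp only [Set.mem_neg, Set.mem_ofPred_eq]
  refine exists_congr fun σ => and_congr_right fun _ => ?_
  constructor <;> intro h <;> linarith

lemma gs_compare (γ : ℝ) (hγ : 0 < γ) (n : ℕ) (hn : Even n) (hn2 : 2 ≤ n) (ε : ℝ)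
    (hε : ε = 1 ∨ ε = -1) :
    |(n : ℝ)⁻¹ * ∫ z, (balancedFinset n).sup' (balanced_nonempty hn)
        (fun σ => -(ε * HD z σ / Real.sqrt (2 * γ))) ∂(poissonProd n γ) + eSK n|
      ≤ 6 * γ ^ (-(1 : ℝ) / 6) := by
  have hn0 : (0 : ℝ) < n := by exact_mod_cast (by omega : 0 < n)
  set S := balancedFinset n with hSdef
  have hS : S.Nonempty := balanced_nonempty hn
  let s : (Fin n → Bool) → Fin n × Fin n → ℝ := fun σ p => spin (σ p.1) * spin (σ p.2)
  have hs : ∀ σ p, s σ p = 1 ∨ s σ p = -1 := by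
    intro σ p
    rcases spin_cases (σ p.1) with h | h <;> rcases spin_cases (σ p.2) with h' | h' <;>
      simp [s, h, h']
  set c : ℝ := (Real.sqrt (2 * n))⁻¹ with hcdef
  have hc : 0 < c := by positivity
  set β : ℝ := γ ^ ((1 : ℝ) / 6) with hβdef
  have hβ : 0 < β := Real.rpow_pos_of_pos hγ _
  set r : NNReal := Real.toNNReal (γ / n) with hr
  have hrc : (r : ℝ) = γ / n := Real.coe_toNNReal _ (by positivity)
  set δ : ℝ := ε * Real.sqrt (n / γ) with hδdef
  have hsq : 0 < Real.sqrt (n / γ) := Real.sqrt_pos.2 (by positivity)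
  have hε2 : ε ^ 2 = 1 := by rcases hε with h | h <;> rw [h] <;> norm_num
  have hεa : |ε| = 1 := by rcases hε with h | h <;> rw [h] <;> norm_num
  have hδ : δ ≠ 0 := by
    have : ε ≠ 0 := by rcases hε with h | h <;> rw [h] <;> norm_num
    positivity
  have hδr : δ ^ 2 * r = 1 := by
    rw [hδdef, mul_pow, hε2, Real.sq_sqrt (by positivity), hrc]
    field_simp
  have key := universal S hS s hs β c hβ hc.le (poisLaw r δ) (ProbabilityTheory.gaussianReal 0 1) δ hδ
    (poisLaw_int r δ) gauss_id_int (poisLaw_stein r δ hδ hδr)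
    (fun h h' C C' hd hcont hC hC' => gauss_stein h h' hd hcont C C' hC hC')
  have hSK : ∫ x, S.sup' hS (fun σ => c * ∑ p, x p * s σ p)
      ∂(Measure.pi fun _ : Fin n × Fin n => ProbabilityTheory.gaussianReal 0 1) = - (n * eSK n) := by
    rw [eSK, ← mul_assoc, mul_inv_cancel₀ hn0.ne', one_mul, ← integral_neg, skMeasure]
    refine integral_congr_ae (ae_of_all _ fun J => ?_)
    simp only
    rw [sInf_bal hS, neg_neg]
    congr 1
    ext σ
    simp only [HSK, s, hcdef]
    simp only [neg_mul, neg_neg, mul_assoc]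
  have hDp : ∫ x, S.sup' hS (fun σ => c * ∑ p, x p * s σ p)
      ∂(Measure.pi fun _ : Fin n × Fin n => poisLaw r δ) =
      ∫ z, S.sup' hS (fun σ => -(ε * HD z σ / Real.sqrt (2 * γ))) ∂(poissonProd n γ) := by
    have mp : MeasurePreserving (fun (z : Fin n × Fin n → ℕ) p => δ * ((z p : ℝ) - r))
        (poissonProd n γ) (Measure.pi fun _ : Fin n × Fin n => poisLaw r δ) := by
      refine measurePreserving_pi _ _ (f := fun _ (k : ℕ) => δ * ((k : ℝ) - r)) fun p => ?_
      exact ⟨by fun_prop, rfl⟩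
    rw [← mp.map_eq, integral_map mp.measurable.aemeasurable
      (Continuous.aestronglyMeasurable (Continuous.finset_sup'_apply hS fun σ _ => by fun_prop))]
    refine integral_congr_ae (ae_of_all _ fun z => ?_)
    refine Finset.sup'_congr hS rfl fun σ hσ => ?_
    have hb : balanced σ := by simpa [hSdef, balancedFinset] using hσ
    have h0 : ∑ p, s σ p = 0 := balanced_sum σ hb
    have e1 : ∑ p, δ * ((z p : ℝ) - r) * s σ p = δ * ∑ p, (z p : ℝ) * s σ p := by
      have : ∀ p, δ * ((z p : ℝ) - r) * s σ p = δ * ((z p : ℝ) * s σ p) - δ * r * s σ p := by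
        intro p; ring
      simp only [this]
      rw [Finset.sum_sub_distrib, ← Finset.mul_sum, ← Finset.mul_sum, h0, mul_zero, sub_zero]
    have e2 : HD z σ = -∑ p, (z p : ℝ) * s σ p := by
      simp only [HD, s, mul_assoc]
    rw [e1, e2]
    have e3 : c * Real.sqrt (n / γ) = (Real.sqrt (2 * γ))⁻¹ := by
      rw [hcdef, ← Real.sqrt_inv, ← Real.sqrt_inv, ← Real.sqrt_mul (by positivity)]
      congr 1
      field_simp
    rw [hδdef, div_eq_mul_inv _ (Real.sqrt (2 * γ)), ← e3]
    ring
  rw [hSK, hDp] at key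
  set I := ∫ z, S.sup' hS (fun σ => -(ε * HD z σ / Real.sqrt (2 * γ))) ∂(poissonProd n γ)
  have hlog : Real.log S.card ≤ n := by
    have h1 : (S.card : ℝ) ≤ 2 ^ n := by
      have : S.card ≤ 2 ^ n := (Finset.card_le_univ S).trans (by simp)
      exact_mod_cast this
    have h2 := Real.log_le_log (by exact_mod_cast hS.card_pos) h1
    rw [Real.log_pow] at h2
    have : Real.log 2 ≤ 1 := by linarith [Real.log_two_lt_d9]
    nlinarith
  have hcard : (Fintype.card (Fin n × Fin n) : ℝ) = n * n := by simp
  have hδa : |δ| = Real.sqrt (n / γ) := by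
    rw [hδdef, abs_mul, hεa, one_mul, abs_of_pos hsq]
  rw [hcard, hδa] at key
  have hc2 : c ^ 2 = (2 * (n : ℝ))⁻¹ := by
    rw [hcdef, inv_pow, Real.sq_sqrt (by positivity)]
  have hcs : c * Real.sqrt (n / γ) = (Real.sqrt (2 * γ))⁻¹ := by
    rw [hcdef, ← Real.sqrt_inv, ← Real.sqrt_inv, ← Real.sqrt_mul (by positivity)]
    congr 1
    field_simp
  have hβi : γ ^ (-(1 : ℝ) / 6) = β⁻¹ := by
    rw [hβdef, ← Real.rpow_neg hγ.le]; norm_num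
  have hβ3 : Real.sqrt γ = β ^ 3 := by
    rw [hβdef, ← Real.rpow_natCast, ← Real.rpow_mul hγ.le, Real.sqrt_eq_rpow]; norm_num
  have hg : (Real.sqrt (2 * γ))⁻¹ ≤ (β ^ 3)⁻¹ := by
    rw [← hβ3]
    apply inv_anti₀ (Real.sqrt_pos.2 hγ)
    exact Real.sqrt_le_sqrt (by linarith)
  have e5 : (n : ℝ) * n * (2 * (2 * c * (β * c) ^ 2) * Real.sqrt (n / γ)) =
      2 * n * β ^ 2 * (Real.sqrt (2 * γ))⁻¹ := by
    calc _ = (n : ℝ) * n * 4 * β ^ 2 * c ^ 2 * (c * Real.sqrt (n / γ)) := by ring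
      _ = _ := by rw [hc2, hcs]; field_simp; ring
  have e6 : 2 * n * β ^ 2 * (Real.sqrt (2 * γ))⁻¹ ≤ 2 * n * β⁻¹ := by
    calc 2 * n * β ^ 2 * (Real.sqrt (2 * γ))⁻¹ ≤ 2 * n * β ^ 2 * (β ^ 3)⁻¹ := by gcongr
      _ = _ := by field_simp
  have e7 : Real.log S.card / β ≤ n * β⁻¹ := by
    rw [div_eq_mul_inv]; gcongr
  rw [e5] at key
  have e8 : (n : ℝ)⁻¹ * I + eSK n = (n : ℝ)⁻¹ * (I - -(n * eSK n)) := by field_simp; ring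
  rw [hβi, e8, abs_mul, abs_of_pos (inv_pos.2 hn0), inv_mul_le_iff₀ hn0]
  have : 0 < β⁻¹ := inv_pos.2 hβ
  nlinarith



/-- **Comparison of diluted and SK constrained ground-state energies**: for
every `γ₀ > 0` there is a finite `A = A(γ₀)` such that for all `γ ≥ γ₀` and
every even `n ≥ 2`, `|e^D_n(γ)/√(2γ) − e^SK_n| ≤ A·γ^{−1/6}` and
`|ê^D_n(γ)/√(2γ) + e^SK_n| ≤ A·γ^{−1/6}`. -/
theorem ground_state_comparison (γ₀ : ℝ) (hγ₀ : 0 < γ₀) :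
    ∃ A : ℝ, ∀ γ : ℝ, γ₀ ≤ γ → ∀ n : ℕ, Even n → 2 ≤ n →
      |eD n γ / Real.sqrt (2 * γ) - eSK n| ≤ A * γ ^ (-(1 : ℝ) / 6)
      ∧ |eHatD n γ / Real.sqrt (2 * γ) + eSK n| ≤ A * γ ^ (-(1 : ℝ) / 6) := by
  refine ⟨6, fun γ hγ n hn hn2 => ?_⟩
  have hγ0 : 0 < γ := hγ₀.trans_le hγ
  have hq : 0 < Real.sqrt (2 * γ) := Real.sqrt_pos.2 (by positivity)
  constructor
  · have h := gs_compare γ hγ0 n hn hn2 1 (Or.inl rfl)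
    rw [← abs_neg]
    convert h using 2
    rw [neg_sub, sub_eq_add_neg, add_comm]
    congr 1
    rw [eD, mul_div_assoc, ← mul_neg, ← integral_div, ← integral_neg]
    congr 1
    refine integral_congr_ae (ae_of_all _ fun z => ?_)
    simp only
    rw [sInf_bal (balanced_nonempty hn), neg_div, neg_neg, div_eq_mul_inv,
      Finset.sup'_mul₀ (by positivity)]
    refine Finset.sup'_congr _ rfl fun σ _ => ?_
    ring
  · have h := gs_compare γ hγ0 n hn hn2 (-1) (Or.inr rfl)
    convert h using 3
    rw [eHatD, mul_div_assoc, ← integral_div]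
    congr 1
    refine integral_congr_ae (ae_of_all _ fun z => ?_)
    simp only
    rw [sSup_bal (balanced_nonempty hn), div_eq_mul_inv,
      Finset.sup'_mul₀ (by positivity)]
    refine Finset.sup'_congr _ rfl fun σ _ => ?_
    ring
end

section
/- Constrained versus unconstrained SK ground state: for every δ > 0, with probability tending to 1 as n → ∞ along even n, 0 ≤ min_{σ∈Ω_n} H^SK_n(σ) − min_{σ∈{−1,+1}^n} H^SK_n(σ) ≤ n^{1/2+δ}. -/
open MeasureTheory Filter Finset

/-- The constrained SK ground state `min_{σ∈Ω_n} H^SK_n(σ)`. -/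
noncomputable def USKconstr (n : ℕ) (J : Fin n × Fin n → ℝ) : ℝ :=
  sInf {x : ℝ | ∃ σ : Fin n → Bool, balanced σ ∧ HSK n J σ = x}

/-- The unconstrained SK ground state `min_{σ∈{−1,+1}^n} H^SK_n(σ)`. -/
noncomputable def USKfree (n : ℕ) (J : Fin n × Fin n → ℝ) : ℝ :=
  sInf {x : ℝ | ∃ σ : Fin n → Bool, HSK n J σ = x}

/-- The quadratic form maximized by the ground state. -/
noncomputable def quadS (n : ℕ) (J : Fin n × Fin n → ℝ) (σ : Fin n → Bool) : ℝ :=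
  ∑ p : Fin n × Fin n, J p * spin (σ p.1) * spin (σ p.2)

/-- Magnetization. -/
noncomputable def magn {n : ℕ} (σ : Fin n → Bool) : ℝ := ∑ i, spin (σ i)

lemma spin_sq (b : Bool) : spin b * spin b = 1 := by cases b <;> simp [spin]

lemma spin_abs (b : Bool) : |spin b| = 1 := by cases b <;> simp [spin]

lemma spin_not (b : Bool) : spin (!b) = - spin b := by cases b <;> simp [spin]

lemma spin_beq (a b : Bool) : spin (a == b) = spin a * spin b := by
  cases a <;> cases b <;> simp [spin]

/-- Flip the spins in `A`. -/
def flipS {n : ℕ} (A : Finset (Fin n)) (σ : Fin n → Bool) : Fin n → Bool :=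
  fun i => if i ∈ A then !σ i else σ i

/-- Local field. -/
noncomputable def locF {n : ℕ} (J : Fin n × Fin n → ℝ) (σ : Fin n → Bool) (i : Fin n) : ℝ :=
  ∑ j, (J (i, j) + J (j, i)) * spin (σ i) * spin (σ j)

lemma sum_locF {n : ℕ} (J : Fin n × Fin n → ℝ) (σ : Fin n → Bool) (x : Fin n → ℝ) :
    ∑ i, x i * locF J σ i
      = ∑ p : Fin n × Fin n, (x p.1 + x p.2) * (J p * spin (σ p.1) * spin (σ p.2)) := by
  have h1 : ∑ p : Fin n × Fin n, (x p.1) * (J p * spin (σ p.1) * spin (σ p.2))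
      = ∑ i, ∑ j, x i * (J (i, j) * spin (σ i) * spin (σ j)) := by
    rw [Fintype.sum_prod_type]
  have h2 : ∑ p : Fin n × Fin n, (x p.2) * (J p * spin (σ p.1) * spin (σ p.2))
      = ∑ i, ∑ j, x i * (J (j, i) * spin (σ j) * spin (σ i)) := by
    rw [Fintype.sum_prod_type_right]
  simp only [add_mul, Finset.sum_add_distrib]
  rw [h1, h2, ← Finset.sum_add_distrib]
  refine Finset.sum_congr rfl fun i _ => ?_
  rw [locF, Finset.mul_sum, ← Finset.sum_add_distrib]
  refine Finset.sum_congr rfl fun j _ => ?_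
  ring

lemma quadS_flip {n : ℕ} (J : Fin n × Fin n → ℝ) (σ : Fin n → Bool) (A : Finset (Fin n)) :
    quadS n J σ - quadS n J (flipS A σ)
      = 2 * ∑ i ∈ A, locF J σ i - 4 * ∑ p ∈ A ×ˢ A, J p * spin (σ p.1) * spin (σ p.2) := by
  classical
  set x : Fin n → ℝ := fun i => if i ∈ A then 1 else 0 with hx
  have hflip : ∀ i, spin (flipS A σ i) = (1 - 2 * x i) * spin (σ i) := by
    intro i
    by_cases h : i ∈ A
    · simp [flipS, hx, h, spin_not]; ring
    · simp [flipS, hx, h]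
  have h1 : ∑ i ∈ A, locF J σ i = ∑ i, x i * locF J σ i := by
    simp [hx]
  have h2 : ∑ p ∈ A ×ˢ A, J p * spin (σ p.1) * spin (σ p.2)
      = ∑ p : Fin n × Fin n, (x p.1 * x p.2) * (J p * spin (σ p.1) * spin (σ p.2)) := by
    rw [← Finset.sum_subset (Finset.subset_univ (A ×ˢ A))]
    · refine Finset.sum_congr rfl fun p hp => ?_
      rw [Finset.mem_product] at hp
      simp [hx, hp.1, hp.2]
    · intro p _ hp
      rw [Finset.mem_product, not_and_or] at hp
      rcases hp with hp | hp <;> simp [hx, hp]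
  rw [h1, h2, sum_locF, quadS, quadS, ← Finset.sum_sub_distrib, Finset.mul_sum, Finset.mul_sum,
    ← Finset.sum_sub_distrib]
  refine Finset.sum_congr rfl fun p _ => ?_
  rw [hflip, hflip]
  ring

lemma count_eq {n : ℕ} (σ : Fin n → Bool) (b : Bool) :
    (Finset.univ.filter fun i => σ i = b).card + (Finset.univ.filter fun i => σ i = !b).card = n := by
  have := Finset.card_filter_add_card_filter_not (s := (Finset.univ : Finset (Fin n))) (fun i => σ i = b)
  simp only [Finset.card_univ, Fintype.card_fin] at this
  have h2 : (Finset.univ.filter fun i => σ i = !b) = Finset.univ.filter fun i => ¬ σ i = b := by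
    refine Finset.filter_congr fun i _ => ?_
    cases σ i <;> cases b <;> simp
  rw [h2]
  exact this

lemma magn_eq {n : ℕ} (σ : Fin n → Bool) :
    magn σ = 2 * ((Finset.univ.filter fun i => σ i = true).card : ℝ) - n := by
  have h := count_eq σ true
  have h' : (((Finset.univ.filter fun i => σ i = true).card : ℕ) : ℝ)
    + ((Finset.univ.filter fun i => σ i = false).card : ℝ) = n := by exact_mod_cast h
  have : magn σ = ∑ i, ((if σ i = true then (1:ℝ) else 0) - (if σ i = false then (1:ℝ) else 0)) := by
    refine Finset.sum_congr rfl fun i _ => ?_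
    cases σ i <;> simp [spin]
  rw [this, Finset.sum_sub_distrib, Finset.sum_boole, Finset.sum_boole]
  linarith

/-- Deterministic repair step. -/
lemma repair {n : ℕ} (hn : 0 < n) (he : Even n) (J : Fin n × Fin n → ℝ) (L : ℝ) (hL : 0 ≤ L)
    (hJ : ∀ p, |J p| ≤ L) (σ : Fin n → Bool) (hσ : ∀ σ', quadS n J σ' ≤ quadS n J σ)
    (hS : quadS n J σ ≤ 2 * n * √n) (t : ℝ) (hM : |magn σ| ≤ t) (htn : 2 * t ≤ n) :
    ∃ σ', balanced σ' ∧ quadS n J σ - quadS n J σ' ≤ t * (16 * √n + 8 * L) + t ^ 2 * L := by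
  classical
  obtain ⟨h, hh⟩ := he
  have hn' : (0:ℝ) < n := by exact_mod_cast hn
  have hnh : (n:ℝ) = 2 * h := by rw [hh]; push_cast; ring
  -- the majority class
  obtain ⟨b, m, hbm, hmt⟩ : ∃ (b : Bool) (m : ℕ),
      (Finset.univ.filter fun i => σ i = b).card = h + m ∧ 2 * (m:ℝ) ≤ t := by
    have hc := count_eq σ true
    have hm := magn_eq σ
    rcases le_total h (Finset.univ.filter fun i => σ i = true).card with hle | hle
    · obtain ⟨m, hm'⟩ := Nat.exists_eq_add_of_le hle
      refine ⟨true, m, hm', ?_⟩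
      rw [hm'] at hm
      push_cast at hm
      have := le_abs_self (magn σ)
      linarith
    · obtain ⟨m, hm'⟩ := Nat.exists_eq_add_of_le hle
      refine ⟨false, m, by simp only [Bool.not_true] at hc; omega, ?_⟩
      have hm'' : (h:ℝ) = ((Finset.univ.filter fun i => σ i = true).card : ℝ) + m := by
        exact_mod_cast hm'
      have := neg_abs_le (magn σ)
      linarith
  set P := Finset.univ.filter fun i => σ i = b with hP
  set K : ℝ := 16 * √n + 8 * L with hK
  have hsq : 0 < √(n:ℝ) := Real.sqrt_pos.2 hn'
  have hKpos : 0 < K := by positivity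
  -- lower bound on local fields
  have hr : ∀ i, 0 ≤ locF J σ i + 2 * L := by
    intro i
    have h1 := quadS_flip J σ {i}
    have h2 := hσ (flipS {i} σ)
    simp only [Finset.sum_singleton, Finset.singleton_product_singleton] at h1
    rw [mul_assoc, spin_sq, mul_one] at h1
    have h3 := neg_abs_le (J (i, i))
    have h4 := hJ (i, i)
    linarith
  have hsum : ∑ i, (locF J σ i + 2 * L) ≤ n * K / 4 := by
    have h1 := sum_locF J σ (fun _ => 1)
    simp only [one_mul, ← Finset.mul_sum] at h1
    rw [Finset.sum_add_distrib, h1]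
    simp only [Finset.sum_const, Finset.card_univ, Fintype.card_fin, nsmul_eq_mul]
    have : ∑ p : Fin n × Fin n, J p * spin (σ p.1) * spin (σ p.2) ≤ 2 * n * √n := hS
    rw [hK]
    nlinarith
  set B := Finset.univ.filter fun i => K < locF J σ i + 2 * L with hB
  have hBc : (B.card : ℝ) ≤ n / 4 := by
    have h1 : B.card * K ≤ ∑ i, (locF J σ i + 2 * L) := by
      calc B.card * K = ∑ i ∈ B, K := by simp
        _ ≤ ∑ i ∈ B, (locF J σ i + 2 * L) :=
            Finset.sum_le_sum fun i hi => (Finset.mem_filter.1 hi).2.le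
        _ ≤ _ := Finset.sum_le_sum_of_subset_of_nonneg (Finset.subset_univ _)
            fun i _ _ => hr i
    have h2 : B.card * K ≤ (n / 4) * K := by linarith
    exact le_of_mul_le_mul_right h2 hKpos
  have hmc : m ≤ (P \ B).card := by
    have h1 := Finset.le_card_sdiff B P
    have h2 : (P.card : ℝ) = h + m := by rw [hbm]; push_cast; ring
    have h3 : P.card ≤ (P \ B).card + B.card := by omega
    have h3' : (P.card : ℝ) ≤ (P \ B).card + B.card := by exact_mod_cast h3
    have : (m : ℝ) ≤ (P \ B).card := by linarith
    exact_mod_cast this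
  obtain ⟨A, hA, hAm⟩ := Finset.exists_subset_card_eq hmc
  have hAP : A ⊆ P := hA.trans Finset.sdiff_subset
  refine ⟨flipS A σ, ?_, ?_⟩
  · have h1 : (Finset.univ.filter fun i => flipS A σ i = b) = P \ A := by
      ext i
      rw [Finset.mem_filter, Finset.mem_sdiff, hP, Finset.mem_filter]
      simp only [Finset.mem_univ, true_and, flipS]
      by_cases hi : i ∈ A
      · have : σ i = b := (Finset.mem_filter.1 (hAP hi)).2
        simp [hi, this]
      · simp [hi]
    have h2 : (Finset.univ.filter fun i => flipS A σ i = b).card = h := by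
      rw [h1, Finset.card_sdiff_of_subset hAP, hAm, hbm]; omega
    have h3 := count_eq (flipS A σ) b
    unfold balanced
    cases b
    · simp only [Bool.not_false] at h3; omega
    · omega
  · rw [quadS_flip]
    have h1 : ∑ i ∈ A, locF J σ i ≤ m * K := by
      calc ∑ i ∈ A, locF J σ i ≤ ∑ i ∈ A, K := by
            refine Finset.sum_le_sum fun i hi => ?_
            have := (Finset.mem_sdiff.1 (hA hi)).2
            simp only [hB, Finset.mem_filter, Finset.mem_univ, true_and, not_lt] at this
            linarith
        _ = m * K := by simp [hAm]
    have h2 : |∑ p ∈ A ×ˢ A, J p * spin (σ p.1) * spin (σ p.2)| ≤ m * m * L := by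
      calc _ ≤ ∑ p ∈ A ×ˢ A, |J p * spin (σ p.1) * spin (σ p.2)| :=
            Finset.abs_sum_le_sum_abs _ _
        _ ≤ ∑ p ∈ A ×ˢ A, L := by
            refine Finset.sum_le_sum fun p _ => ?_
            rw [abs_mul, abs_mul, spin_abs, spin_abs, mul_one, mul_one]
            exact hJ p
        _ = m * m * L := by simp [hAm]
    have h3 := neg_abs_le (∑ p ∈ A ×ˢ A, J p * spin (σ p.1) * spin (σ p.2))
    have hm0 : (0:ℝ) ≤ m := Nat.cast_nonneg m
    have h4 : (2 * (m:ℝ)) ^ 2 * L ≤ t ^ 2 * L := by gcongr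
    have h5 : 2 * (m:ℝ) * K ≤ t * K := by gcongr
    nlinarith

open ProbabilityTheory in
lemma lin_tail {ι : Type*} [Fintype ι] (s : Finset ι) (c : ι → ℝ) (hc : ∀ i, c i ^ 2 = 1) {a : ℝ}
    (ha : 0 ≤ a) :
    (Measure.pi fun _ : ι => gaussianReal 0 1).real {J | a ≤ ∑ i ∈ s, c i * J i}
      ≤ Real.exp (-a ^ 2 / (2 * s.card)) := by
  have hind : iIndepFun (fun (i : ι) (J : ι → ℝ) => c i * J i)
      (Measure.pi fun _ : ι => gaussianReal 0 1) :=
    iIndepFun_pi (X := fun i x => c i * x) (fun i => by fun_prop)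
  have hg : HasSubgaussianMGF (fun x : ℝ => x) 1 (gaussianReal 0 1) := by
    refine ⟨fun t => integrable_exp_mul_gaussianReal t, fun t => ?_⟩
    rw [mgf_gaussianReal (μ := 0) (v := 1) (by simp)]
    simp
  have hsub : ∀ i ∈ s, HasSubgaussianMGF (fun J : ι → ℝ => c i * J i) 1
      (Measure.pi fun _ : ι => gaussianReal 0 1) := by
    intro i _
    have h1 : HasSubgaussianMGF (fun J : ι → ℝ => J i) 1
        (Measure.pi fun _ : ι => gaussianReal 0 1) := by
      have h2 := (measurePreserving_eval (fun _ : ι => gaussianReal 0 1) i)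
      rw [← h2.map_eq] at hg
      exact HasSubgaussianMGF.of_map h2.measurable.aemeasurable hg
    have h3 := h1.const_mul (c i)
    convert h3 using 1
    ext
    change (1:ℝ) = c i ^ 2 * 1
    rw [hc, mul_one]
  have := HasSubgaussianMGF.measure_sum_ge_le_of_iIndepFun hind hsub ha
  simpa using this

instance (n : ℕ) : IsProbabilityMeasure (skMeasure n) := by
  unfold skMeasure; infer_instance

lemma spin_pow (b : Bool) : spin b ^ 2 = 1 := by rw [sq, spin_sq]

lemma event_one (n : ℕ) (hn : 0 < n) :
    (skMeasure n).real {J | ∃ σ, 2 * n * √n ≤ quadS n J σ} ≤ Real.exp (-n) := by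
  have hn' : (0:ℝ) < n := by exact_mod_cast hn
  have h1 : ∀ σ : Fin n → Bool,
      (skMeasure n).real {J | 2 * n * √n ≤ quadS n J σ} ≤ Real.exp (-(2 * n)) := by
    intro σ
    have := lin_tail (Finset.univ : Finset (Fin n × Fin n))
      (fun p => spin (σ p.1) * spin (σ p.2)) (fun p => by rw [mul_pow, spin_pow, spin_pow, one_mul])
      (a := 2 * n * √n) (by positivity)
    have e : -(2 * (n:ℝ) * √n) ^ 2 / (2 * ((Finset.univ : Finset (Fin n × Fin n)).card : ℝ))
        = -(2 * n) := by
      simp only [Finset.card_univ, Fintype.card_prod, Fintype.card_fin, Nat.cast_mul, mul_pow,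
        Real.sq_sqrt hn'.le]
      field_simp
    rw [e] at this
    have e2 : ∀ J, quadS n J σ = ∑ p, spin (σ p.1) * spin (σ p.2) * J p := fun J =>
      Finset.sum_congr rfl fun p _ => by ring
    simp only [e2]
    exact this
  have h2 : {J | ∃ σ, 2 * n * √n ≤ quadS n J σ} = ⋃ σ, {J | 2 * n * √n ≤ quadS n J σ} := by
    ext; simp
  rw [h2]
  calc _ ≤ ∑ σ : Fin n → Bool, (skMeasure n).real {J | 2 * n * √n ≤ quadS n J σ} :=
        measureReal_iUnion_fintype_le _
    _ ≤ ∑ σ : Fin n → Bool, Real.exp (-(2 * n)) := Finset.sum_le_sum fun σ _ => h1 σ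
    _ = 2 ^ n * Real.exp (-(2 * n)) := by simp
    _ ≤ Real.exp n * Real.exp (-(2 * n)) := by
        gcongr
        rw [← mul_one (n:ℝ), Real.exp_nat_mul]
        gcongr
        have := Real.add_one_le_exp 1
        linarith
    _ = Real.exp (-n) := by rw [← Real.exp_add]; congr 1; ring

lemma event_two (n : ℕ) (L : ℝ) (hL : 0 ≤ L) :
    (skMeasure n).real {J | ∃ p, L ≤ |J p|} ≤ 2 * (n ^ 2 * Real.exp (-L ^ 2 / 2)) := by
  have key : ∀ c : ℝ, c ^ 2 = 1 → ∀ p : Fin n × Fin n,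
      (skMeasure n).real {J | L ≤ c * J p} ≤ Real.exp (-L ^ 2 / 2) := by
    intro c hc p
    simpa using! lin_tail {p} (fun _ => c) (fun _ => hc) hL
  have h2 : {J : Fin n × Fin n → ℝ | ∃ p, L ≤ |J p|}
      = ⋃ p, ({J | L ≤ 1 * J p} ∪ {J | L ≤ (-1) * J p}) := by
    ext; simp [le_abs]
  rw [h2]
  calc _ ≤ ∑ p : Fin n × Fin n, (skMeasure n).real ({J | L ≤ 1 * J p} ∪ {J | L ≤ (-1) * J p}) :=
        measureReal_iUnion_fintype_le _
    _ ≤ ∑ p : Fin n × Fin n, (Real.exp (-L ^ 2 / 2) + Real.exp (-L ^ 2 / 2)) :=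
        Finset.sum_le_sum fun p _ => (measureReal_union_le _ _).trans
          (add_le_add (key 1 (by norm_num) p) (key (-1) (by norm_num) p))
    _ = _ := by simp; ring

/-- Gauge transformation. -/
noncomputable def gaugeT {n : ℕ} (τ : Fin n → Bool) (J : Fin n × Fin n → ℝ) : Fin n × Fin n → ℝ :=
  fun p => spin (τ p.1) * spin (τ p.2) * J p

lemma gaugeT_mp {n : ℕ} (τ : Fin n → Bool) :
    MeasurePreserving (gaugeT τ) (skMeasure n) (skMeasure n) := by
  unfold skMeasure gaugeT
  refine measurePreserving_pi _ _ (f := fun (p : Fin n × Fin n) x => spin (τ p.1) * spin (τ p.2) * x) fun p => ?_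
  refine ⟨by fun_prop, ?_⟩
  rw [ProbabilityTheory.gaussianReal_map_const_mul]
  congr 1
  · simp
  · ext; simp [mul_pow, spin_pow]

lemma quadS_gaugeT {n : ℕ} (τ σ : Fin n → Bool) (J : Fin n × Fin n → ℝ) :
    quadS n (gaugeT τ J) σ = quadS n J (fun i => τ i == σ i) := by
  unfold quadS gaugeT
  refine Finset.sum_congr rfl fun p _ => ?_
  rw [spin_beq, spin_beq]; ring

lemma sum_spin {n : ℕ} (i j : Fin n) :
    ∑ τ : Fin n → Bool, spin (τ i) * spin (τ j) = if i = j then 2 ^ n else 0 := by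
  classical
  split_ifs with h
  · subst h
    simp [spin_sq]
  · have hinv : Function.Involutive (flipS ({i} : Finset (Fin n)) : (Fin n → Bool) → (Fin n → Bool)) := by
      intro τ; ext k; by_cases hk : k = i <;> simp [flipS, hk]
    let e : Equiv.Perm (Fin n → Bool) := ⟨flipS {i}, flipS {i}, hinv, hinv⟩
    have h1 := Equiv.sum_comp e (fun τ : Fin n → Bool => spin (τ i) * spin (τ j))
    have h2 : ∑ τ : Fin n → Bool, spin (e τ i) * spin (e τ j)
        = - ∑ τ : Fin n → Bool, spin (τ i) * spin (τ j) := by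
      rw [← Finset.sum_neg_distrib]
      refine Finset.sum_congr rfl fun τ _ => ?_
      change spin (flipS {i} τ i) * spin (flipS {i} τ j) = _
      simp [flipS, Ne.symm h, spin_not]
    linarith

lemma sum_magn_sq {n : ℕ} (σ : Fin n → Bool) :
    ∑ τ : Fin n → Bool, magn (fun i => τ i == σ i) ^ 2 = n * 2 ^ n := by
  have : ∀ τ : Fin n → Bool, magn (fun i => τ i == σ i) ^ 2
      = ∑ i, ∑ j, (spin (σ i) * spin (σ j)) * (spin (τ i) * spin (τ j)) := by
    intro τ
    rw [magn, sq, Finset.sum_mul_sum]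
    refine Finset.sum_congr rfl fun i _ => Finset.sum_congr rfl fun j _ => ?_
    rw [spin_beq, spin_beq]; ring
  simp only [this]
  rw [Finset.sum_comm]
  have h2 : ∀ i : Fin n, ∑ τ : Fin n → Bool, ∑ j, (spin (σ i) * spin (σ j)) * (spin (τ i) * spin (τ j))
      = 2 ^ n := by
    intro i
    rw [Finset.sum_comm]
    simp only [← Finset.mul_sum, sum_spin]
    simp [spin_sq]
  simp [h2]

/-- All maximizers have large magnetization. -/
def badM (n : ℕ) (t : ℝ) : Set (Fin n × Fin n → ℝ) :=
  {J | ∀ σ, (∀ σ', quadS n J σ' ≤ quadS n J σ) → t < |magn σ|}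

lemma meas_quadS (n : ℕ) (σ : Fin n → Bool) : Measurable fun J => quadS n J σ := by
  unfold quadS; fun_prop

lemma meas_badM (n : ℕ) (t : ℝ) : MeasurableSet (badM n t) := by
  unfold badM
  simp only [Set.ofPred_forall]
  refine MeasurableSet.iInter fun σ => ?_
  have h : MeasurableSet {J | ∀ σ', quadS n J σ' ≤ quadS n J σ} := by
    simp only [Set.ofPred_forall]
    exact MeasurableSet.iInter fun σ' => measurableSet_le (meas_quadS n σ') (meas_quadS n σ)
  by_cases ht : t < |magn σ|
  · simp [ht]
  · simpa only [ht, imp_false] using! h.compl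

lemma event_three (n : ℕ) (t : ℝ) (ht : 0 < t) : (skMeasure n).real (badM n t) ≤ n / t ^ 2 := by
  classical
  have hpt : ∀ J, ∑ τ : Fin n → Bool, (gaugeT τ ⁻¹' badM n t).indicator (fun _ => (1:ℝ)) J
      ≤ n * 2 ^ n / t ^ 2 := by
    intro J
    obtain ⟨σ, hσ⟩ := Finite.exists_max (fun σ => quadS n J σ)
    rw [← sum_magn_sq σ, Finset.sum_div]
    refine Finset.sum_le_sum fun τ _ => ?_
    by_cases hτ : J ∈ gaugeT τ ⁻¹' badM n t
    · rw [Set.indicator_of_mem hτ]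
      have h1 : t < |magn (fun i => τ i == σ i)| := by
        refine hτ _ fun σ' => ?_
        rw [quadS_gaugeT, quadS_gaugeT]
        refine (hσ _).trans (le_of_eq ?_)
        congr 1
        ext i
        cases τ i <;> cases σ i <;> rfl
      rw [one_le_div (by positivity), ← sq_abs (magn _)]
      gcongr
    · rw [Set.indicator_of_notMem hτ]; positivity
  have hm : ∀ τ : Fin n → Bool, MeasurableSet (gaugeT τ ⁻¹' badM n t) := fun τ =>
    (gaugeT_mp τ).measurable (meas_badM n t)
  have h1 : ∫ J, ∑ τ : Fin n → Bool, (gaugeT τ ⁻¹' badM n t).indicator (fun _ => (1:ℝ)) J ∂(skMeasure n)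
      = 2 ^ n * (skMeasure n).real (badM n t) := by
    rw [integral_finsetSum]
    · have : ∀ τ : Fin n → Bool, ∫ J, (gaugeT τ ⁻¹' badM n t).indicator (fun _ => (1:ℝ)) J ∂(skMeasure n)
          = (skMeasure n).real (badM n t) := by
        intro τ
        rw [integral_indicator_const _ (hm τ), smul_eq_mul, mul_one, measureReal_def, measureReal_def,
          (gaugeT_mp τ).measure_preimage (meas_badM n t).nullMeasurableSet]
      simp [this]
    · intro τ _
      exact (integrable_const _).indicator (hm τ)
  have h2 : ∫ J, ∑ τ : Fin n → Bool, (gaugeT τ ⁻¹' badM n t).indicator (fun _ => (1:ℝ)) J ∂(skMeasure n)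
      ≤ n * 2 ^ n / t ^ 2 := by
    calc _ ≤ ∫ J, (n * 2 ^ n / t ^ 2 : ℝ) ∂(skMeasure n) := by
          refine integral_mono ?_ (integrable_const _) hpt
          exact integrable_finsetSum _ fun τ _ => (integrable_const _).indicator (hm τ)
      _ = _ := by simp
  rw [h1] at h2
  have : (2:ℝ) ^ n * (skMeasure n).real (badM n t) ≤ 2 ^ n * (n / t ^ 2) := by
    refine h2.trans (le_of_eq (by ring))
  exact le_of_mul_le_mul_left this (by positivity)

lemma HSK_eq (n : ℕ) (J : Fin n × Fin n → ℝ) (σ : Fin n → Bool) :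
    HSK n J σ = -((√(2 * n))⁻¹ * quadS n J σ) := by
  rw [HSK, quadS, neg_mul]

lemma exists_balanced {n : ℕ} (he : Even n) : ∃ σ : Fin n → Bool, balanced σ := by
  classical
  obtain ⟨h, hh⟩ := he
  obtain ⟨A, _, hA⟩ := Finset.exists_subset_card_eq
    (s := (Finset.univ : Finset (Fin n))) (n := h) (by simp; omega)
  refine ⟨fun i => decide (i ∈ A), ?_⟩
  simp [balanced, hA]
  omega

lemma constr_bdd (n : ℕ) (J : Fin n × Fin n → ℝ) :
    BddBelow {x : ℝ | ∃ σ : Fin n → Bool, balanced σ ∧ HSK n J σ = x} := by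
  refine Set.Finite.bddBelow ((Set.finite_range (HSK n J)).subset ?_)
  rintro x ⟨σ, -, rfl⟩
  exact ⟨σ, rfl⟩

lemma free_eq {n : ℕ} (J : Fin n × Fin n → ℝ) (σ : Fin n → Bool)
    (hσ : ∀ σ', quadS n J σ' ≤ quadS n J σ) : USKfree n J = HSK n J σ := by
  refine IsLeast.csInf_eq ⟨⟨σ, rfl⟩, ?_⟩
  rintro x ⟨σ', rfl⟩
  rw [HSK_eq, HSK_eq]
  have := hσ σ'
  gcongr

lemma gap_nonneg {n : ℕ} (he : Even n) (J : Fin n × Fin n → ℝ) :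
    0 ≤ USKconstr n J - USKfree n J := by
  obtain ⟨σ₀, hσ₀⟩ := exists_balanced he
  rw [sub_nonneg]
  refine le_csInf ⟨_, σ₀, hσ₀, rfl⟩ ?_
  rintro x ⟨σ, -, rfl⟩
  refine csInf_le (Set.Finite.bddBelow ((Set.finite_range (HSK n J)).subset ?_)) ⟨σ, rfl⟩
  rintro x ⟨σ, rfl⟩
  exact ⟨σ, rfl⟩

/-- On the good event the gap is small. -/
lemma good_gap {n : ℕ} (hn : 0 < n) (he : Even n) (J : Fin n × Fin n → ℝ) (x : ℝ) (hx : 25 ≤ x)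
    (hxn : x ^ 4 ≤ √n) (h1 : ¬ ∃ σ, 2 * n * √n ≤ quadS n J σ) (h2 : ¬ ∃ p, x ≤ |J p|)
    (h3 : J ∉ badM n (√n * x)) :
    USKconstr n J - USKfree n J ≤ √n * x ^ 4 := by
  push Not at h1 h2
  simp only [badM, Set.mem_ofPred_eq, not_forall, not_lt] at h3
  obtain ⟨σ, hσ, hM⟩ := h3
  have hn' : (0:ℝ) < n := by exact_mod_cast hn
  set y := √(n:ℝ) with hy
  have hy0 : 0 < y := Real.sqrt_pos.2 hn'
  have hyy : y * y = n := Real.mul_self_sqrt hn'.le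
  have hx3 : (2:ℝ) ≤ x ^ 3 := le_trans (by norm_num) (pow_le_pow_left₀ (by norm_num) hx 3)
  have hx0 : 0 < x := by linarith
  have h2x : 2 * x ≤ y := by nlinarith
  obtain ⟨σ', hb, hg⟩ := repair hn he J x hx0.le (fun p => (h2 p).le) σ hσ (h1 σ).le (y * x) hM
    (by rw [← hyy]; nlinarith)
  have hc : USKconstr n J ≤ HSK n J σ' := csInf_le (constr_bdd n J) ⟨σ', hb, rfl⟩
  rw [free_eq J σ hσ]
  have h4 : HSK n J σ' - HSK n J σ = (√(2 * n))⁻¹ * (quadS n J σ - quadS n J σ') := by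
    rw [HSK_eq, HSK_eq]; ring
  have h5 : (√(2 * (n:ℝ)))⁻¹ ≤ y⁻¹ := by
    rw [hy]; gcongr; linarith
  have h6 : quadS n J σ - quadS n J σ' ≥ 0 := by linarith [hσ σ']
  calc _ ≤ (√(2 * n))⁻¹ * (quadS n J σ - quadS n J σ') := by linarith
    _ ≤ y⁻¹ * (y * x * (16 * y + 8 * x) + (y * x) ^ 2 * x) := by gcongr
    _ = 16 * (x * y) + 8 * x ^ 2 + y * x ^ 3 := by field_simp
    _ ≤ 25 * (y * x ^ 3) := by
        have a1 : x * y ≤ y * x ^ 3 := by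
          have : x * y * 1 ≤ x * y * x ^ 2 := by gcongr; nlinarith
          nlinarith
        have a2 : x ^ 2 ≤ y * x ^ 3 := by
          have : x ^ 2 * 1 ≤ x ^ 2 * (y * x) := by gcongr; nlinarith
          nlinarith
        linarith
    _ ≤ x * (y * x ^ 3) := by gcongr
    _ = _ := by ring

lemma prob_bound {n : ℕ} (hn : 0 < n) (he : Even n) (δ ε : ℝ) (hεδ : 4 * ε ≤ δ)
    (hε8 : ε ≤ 1 / 8) (hx : 25 ≤ (n:ℝ) ^ ε) :
    1 - (Real.exp (-n) + 2 * ((n:ℝ) ^ 2 * Real.exp (-((n:ℝ) ^ ε) ^ 2 / 2)) + ((n:ℝ) ^ ε)⁻¹ ^ 2)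
      ≤ ((skMeasure n)
          {J | 0 ≤ USKconstr n J - USKfree n J
              ∧ USKconstr n J - USKfree n J ≤ (n : ℝ) ^ ((1 : ℝ) / 2 + δ)}).toReal := by
  have hn' : (0:ℝ) < n := by exact_mod_cast hn
  have hn1 : (1:ℝ) ≤ n := by exact_mod_cast hn
  set x := (n:ℝ) ^ ε with hxd
  have hx0 : 0 < x := by linarith
  have hy0 : 0 < √(n:ℝ) := Real.sqrt_pos.2 hn'
  have hx4 : x ^ 4 = (n:ℝ) ^ (4 * ε) := by
    rw [hxd, ← Real.rpow_natCast, ← Real.rpow_mul hn'.le]; congr 1; push_cast; ring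
  have hxn : x ^ 4 ≤ √n := by
    rw [hx4, Real.sqrt_eq_rpow]
    exact Real.rpow_le_rpow_of_exponent_le hn1 (by linarith)
  have hyx : √n * x ^ 4 ≤ (n : ℝ) ^ ((1 : ℝ) / 2 + δ) := by
    rw [hx4, Real.sqrt_eq_rpow, ← Real.rpow_add hn']
    exact Real.rpow_le_rpow_of_exponent_le hn1 (by linarith)
  set G := {J | 0 ≤ USKconstr n J - USKfree n J
              ∧ USKconstr n J - USKfree n J ≤ (n : ℝ) ^ ((1 : ℝ) / 2 + δ)} with hG
  have hcov : (Set.univ : Set (Fin n × Fin n → ℝ)) ⊆ G ∪ ({J | ∃ σ, 2 * n * √n ≤ quadS n J σ}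
      ∪ {J | ∃ p, x ≤ |J p|} ∪ badM n (√n * x)) := by
    intro J _
    by_contra hJ
    simp only [Set.mem_union, not_or] at hJ
    obtain ⟨hJ0, ⟨h1, h2⟩, h3⟩ := hJ
    exact hJ0 ⟨gap_nonneg he J, (good_gap hn he J x hx hxn h1 h2 h3).trans hyx⟩
  have hu : (1:ℝ) ≤ (skMeasure n).real G + ((skMeasure n).real {J | ∃ σ, 2 * n * √n ≤ quadS n J σ}
      + (skMeasure n).real {J | ∃ p, x ≤ |J p|} + (skMeasure n).real (badM n (√n * x))) := by
    calc (1:ℝ) = (skMeasure n).real Set.univ := by simp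
      _ ≤ _ := measureReal_mono hcov
      _ ≤ _ := measureReal_union_le _ _
      _ ≤ _ := by
        gcongr
        refine (measureReal_union_le _ _).trans ?_
        gcongr
        exact measureReal_union_le _ _
  have e1 := event_one n hn
  have e2 := event_two n x hx0.le
  have e3 := event_three n (√n * x) (by positivity)
  have e3' : (n:ℝ) / (√n * x) ^ 2 = x⁻¹ ^ 2 := by
    rw [mul_pow, Real.sq_sqrt hn'.le]; field_simp
  rw [e3'] at e3
  change _ ≤ (skMeasure n).real G
  linarith

lemma err_tendsto (ε : ℝ) (hε : 0 < ε) :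
    Tendsto (fun n : ℕ => 1 - (Real.exp (-n) + 2 * ((n:ℝ) ^ 2 * Real.exp (-((n:ℝ) ^ ε) ^ 2 / 2))
      + ((n:ℝ) ^ ε)⁻¹ ^ 2)) atTop (nhds 1) := by
  have hx : Tendsto (fun n : ℕ => (n:ℝ) ^ ε) atTop atTop :=
    (tendsto_rpow_atTop hε).comp tendsto_natCast_atTop_atTop
  have t1 : Tendsto (fun n : ℕ => Real.exp (-(n:ℝ))) atTop (nhds 0) :=
    Real.tendsto_exp_neg_atTop_nhds_zero.comp tendsto_natCast_atTop_atTop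
  have t3 : Tendsto (fun n : ℕ => ((n:ℝ) ^ ε)⁻¹ ^ 2) atTop (nhds 0) := by
    have := (tendsto_inv_atTop_zero.comp hx).pow 2
    simpa using! this
  have t2 : Tendsto (fun n : ℕ => (n:ℝ) ^ 2 * Real.exp (-((n:ℝ) ^ ε) ^ 2 / 2)) atTop (nhds 0) := by
    have h := (tendsto_rpow_mul_exp_neg_mul_atTop_nhds_zero (1 / ε) (1 / 2) (by norm_num)).comp
      ((tendsto_pow_atTop (two_ne_zero)).comp hx)
    refine h.congr fun n => ?_
    simp only [Function.comp]
    have hn : (0:ℝ) ≤ n := Nat.cast_nonneg n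
    congr 1
    · rw [← Real.rpow_natCast, ← Real.rpow_mul hn, ← Real.rpow_mul hn, ← Real.rpow_natCast]
      congr 1
      field_simp
    · congr 1; ring
  have := (((t1.add (t2.const_mul 2)).add t3).const_sub 1)
  simpa using this

/-- **Constrained versus unconstrained SK ground state**: for every `δ > 0`,
with probability tending to 1 as `n → ∞` along even `n`,
`0 ≤ min_{σ∈Ω_n} H^SK_n(σ) − min_{σ∈{−1,+1}^n} H^SK_n(σ) ≤ n^{1/2+δ}`. -/
theorem constrained_vs_unconstrained_SK (δ : ℝ) (hδ : 0 < δ) :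
    Tendsto (fun n : ℕ =>
        ((skMeasure n)
          {J | 0 ≤ USKconstr n J - USKfree n J
              ∧ USKconstr n J - USKfree n J ≤ (n : ℝ) ^ ((1 : ℝ) / 2 + δ)}).toReal)
      (atTop ⊓ Filter.principal {n : ℕ | Even n}) (nhds 1) := by
  set ε := min (δ / 4) (1 / 8) with hε
  have hε0 : 0 < ε := lt_min (by linarith) (by norm_num)
  have hx : Tendsto (fun n : ℕ => (n:ℝ) ^ ε) atTop atTop :=
    (tendsto_rpow_atTop hε0).comp tendsto_natCast_atTop_atTop
  refine tendsto_of_tendsto_of_tendsto_of_le_of_le' ((err_tendsto ε hε0).mono_left inf_le_left)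
    tendsto_const_nhds ?_ ?_
  · have hev : ∀ᶠ n : ℕ in atTop, 0 < n ∧ 25 ≤ (n:ℝ) ^ ε :=
      (eventually_gt_atTop 0).and (hx.eventually_ge_atTop 25)
    filter_upwards [hev.filter_mono inf_le_left,
      (eventually_principal.2 (fun n hn => hn) : ∀ᶠ n in Filter.principal {n : ℕ | Even n}, Even n).filter_mono
        inf_le_right] with n h1 h2
    exact prob_bound h1.1 h2 δ ε (by have := min_le_left (δ / 4) (1 / 8 : ℝ); linarith)
      (min_le_right _ _) h1.2
  · exact Eventually.of_forall fun n => measureReal_le_one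
end

section
/- Limit of the constrained SK ground-state energy density: as n → ∞ along even n, n^{−1} E[min_{σ∈Ω_n} H^SK_n(σ)] → −P_*. In particular, the constrained and unconstrained ground-state energy densities have the same limit: n^{−1} ( E[min_{σ∈Ω_n} H^SK_n(σ)] − E[min_{σ∈{−1,+1}^n} H^SK_n(σ)] ) → 0. -/
open MeasureTheory Filter Finset

namespace SKaux

/-- Pointwise product of spin configurations. -/
def bm {n : ℕ} (a b : Fin n → Bool) : Fin n → Bool := fun i => a i == b i

/-- Gauge transformation of the couplings. -/
noncomputable def gauge {n : ℕ} (τ : Fin n → Bool) (J : Fin n × Fin n → ℝ) : Fin n × Fin n → ℝ :=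
  fun p => (spin (τ p.1) * spin (τ p.2)) * J p

lemma spin_beq (a b : Bool) : spin (a == b) = spin a * spin b := by
  cases a <;> cases b <;> simp [spin]

lemma spin_sq (a : Bool) : spin a * spin a = 1 := by cases a <;> simp [spin]

lemma bm_bm {n : ℕ} (a b : Fin n → Bool) : bm a (bm a b) = b := by
  funext i; simp only [bm]; cases a i <;> cases b i <;> rfl

lemma HSK_gauge {n : ℕ} (τ σ : Fin n → Bool) (J : Fin n × Fin n → ℝ) :
    HSK n (gauge τ J) σ = HSK n J (bm τ σ) := by
  unfold HSK gauge bm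
  congr 1
  refine Finset.sum_congr rfl fun p _ => ?_
  rw [spin_beq, spin_beq]; ring

instance (n : ℕ) : IsProbabilityMeasure (skMeasure n) := by
  unfold skMeasure; infer_instance

lemma mp_eval {n : ℕ} (p : Fin n × Fin n) :
    MeasurePreserving (fun J : Fin n × Fin n → ℝ => J p) (skMeasure n)
      (ProbabilityTheory.gaussianReal 0 1) := by
  unfold skMeasure
  exact measurePreserving_eval (fun _ : Fin n × Fin n => ProbabilityTheory.gaussianReal 0 1) p

lemma int_id : Integrable (fun x : ℝ => x) (ProbabilityTheory.gaussianReal 0 1) :=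
  (ProbabilityTheory.memLp_id_gaussianReal (μ := 0) (v := 1) 1).integrable (by simp)

lemma int_eval {n : ℕ} (p : Fin n × Fin n) :
    Integrable (fun J : Fin n × Fin n → ℝ => J p) (skMeasure n) :=
  (mp_eval p).integrable_comp_of_integrable int_id

lemma integral_eval {n : ℕ} (p : Fin n × Fin n) :
    ∫ J, J p ∂(skMeasure n) = 0 := by
  have h := integral_map (μ := skMeasure n) (φ := fun J : Fin n × Fin n → ℝ => J p)
    (f := fun x : ℝ => x) (mp_eval p).measurable.aemeasurable (by fun_prop)
  rw [(mp_eval p).map_eq, ProbabilityTheory.integral_id_gaussianReal] at h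
  exact h.symm

lemma mp_gauge {n : ℕ} (τ : Fin n → Bool) :
    MeasurePreserving (gauge τ) (skMeasure n) (skMeasure n) := by
  unfold skMeasure gauge
  refine measurePreserving_pi (f := fun (p : Fin n × Fin n) (x : ℝ) => (spin (τ p.1) * spin (τ p.2)) * x) _ _ fun p => ?_
  refine ⟨by fun_prop, ?_⟩
  rw [ProbabilityTheory.gaussianReal_map_const_mul]
  have : (spin (τ p.1) * spin (τ p.2))^2 = 1 := by
    cases τ p.1 <;> cases τ p.2 <;> simp [spin]
  congr 1
  · simp
  · ext; simp [this]

lemma int_HSK {n : ℕ} (σ : Fin n → Bool) : Integrable (fun J => HSK n J σ) (skMeasure n) := by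
  unfold HSK
  refine Integrable.const_mul (integrable_finsetSum _ fun p _ => ?_) _
  exact ((int_eval p).mul_const _).mul_const _

lemma int_inf {α ι : Type*} [MeasurableSpace α] {μ : Measure α} (s : Finset ι) (hs : s.Nonempty)
    (F : ι → α → ℝ) (hF : ∀ i, Integrable (F i) μ) :
    Integrable (fun a => s.inf' hs (fun i => F i a)) μ := by
  induction hs using Finset.Nonempty.cons_induction with
  | singleton a => simpa using hF a
  | cons a s h hs ih =>
    simp only [Finset.inf'_cons hs]
    exact (hF a).inf ih

open Classical in
lemma constr_eq {n : ℕ} (h : (Finset.univ.filter fun σ : Fin n → Bool => balanced σ).Nonempty)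
    (J : Fin n × Fin n → ℝ) :
    USKconstr n J = (Finset.univ.filter fun σ : Fin n → Bool => balanced σ).inf' h
      (fun σ => HSK n J σ) := by
  rw [Finset.inf'_eq_csInf_image]
  unfold USKconstr
  congr 1
  ext x; simp

lemma free_eq {n : ℕ} (J : Fin n × Fin n → ℝ) :
    USKfree n J = (Finset.univ : Finset (Fin n → Bool)).inf' Finset.univ_nonempty
      (fun σ => HSK n J σ) := by
  rw [Finset.inf'_eq_csInf_image]
  unfold USKfree
  congr 1
  ext x; simp

lemma free_eq_neg_sup {n : ℕ} (J : Fin n × Fin n → ℝ) :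
    (⨆ σ : Fin n → Bool, -HSK n J σ) = - USKfree n J := by
  unfold USKfree
  have : {x : ℝ | ∃ σ : Fin n → Bool, HSK n J σ = x} = Set.range (fun σ => HSK n J σ) := rfl
  rw [this, Real.sInf_def, neg_neg, iSup]
  congr 1
  ext x; simp [neg_eq_iff_eq_neg]

lemma int_free (n : ℕ) : Integrable (USKfree n) (skMeasure n) := by
  have : USKfree n = fun J => _ := funext fun J => free_eq J
  rw [this]
  exact int_inf _ _ _ int_HSK

open Classical in
lemma int_constr (n : ℕ) (h : ∃ σ : Fin n → Bool, balanced σ) :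
    Integrable (USKconstr n) (skMeasure n) := by
  have h' : (Finset.univ.filter fun σ : Fin n → Bool => balanced σ).Nonempty := by
    obtain ⟨σ, hσ⟩ := h; exact ⟨σ, by simpa using hσ⟩
  have : USKconstr n = fun J => _ := funext fun J => constr_eq h' J
  rw [this]
  exact int_inf _ _ _ int_HSK

lemma constr_le {n : ℕ} (σ : Fin n → Bool) (hσ : balanced σ) (J : Fin n × Fin n → ℝ) :
    USKconstr n J ≤ HSK n J σ := by
  classical
  have h' : (Finset.univ.filter fun σ : Fin n → Bool => balanced σ).Nonempty :=
    ⟨σ, by simpa using hσ⟩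
  rw [constr_eq h']
  exact Finset.inf'_le _ (by simpa using hσ)

lemma free_le_constr {n : ℕ} (h : ∃ σ : Fin n → Bool, balanced σ) (J : Fin n × Fin n → ℝ) :
    USKfree n J ≤ USKconstr n J := by
  classical
  have h' : (Finset.univ.filter fun σ : Fin n → Bool => balanced σ).Nonempty := by
    obtain ⟨σ, hσ⟩ := h; exact ⟨σ, by simpa using hσ⟩
  rw [constr_eq h', free_eq]
  exact Finset.inf'_mono _ (Finset.subset_univ _) h'

lemma exists_free {n : ℕ} (J : Fin n × Fin n → ℝ) : ∃ x : Fin n → Bool, HSK n J x = USKfree n J := by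
  rw [free_eq]
  obtain ⟨x, _, hx⟩ := Finset.exists_mem_eq_inf' (Finset.univ_nonempty (α := Fin n → Bool))
    (fun σ => HSK n J σ)
  exact ⟨x, hx.symm⟩

lemma integral_gauge {n : ℕ} (h : ∃ σ : Fin n → Bool, balanced σ) (τ : Fin n → Bool) :
    ∫ J, USKconstr n (gauge τ J) ∂(skMeasure n) = ∫ J, USKconstr n J ∂(skMeasure n) := by
  have h1 := integral_map (μ := skMeasure n) (φ := gauge τ)
    (f := USKconstr n) (mp_gauge τ).measurable.aemeasurable
    (by rw [(mp_gauge τ).map_eq]; exact (int_constr n h).aestronglyMeasurable)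
  rw [(mp_gauge τ).map_eq] at h1
  exact h1.symm

/-- magnetization -/
noncomputable def mag {n : ℕ} (y : Fin n → Bool) : ℝ := ∑ i, spin (y i)

/-- every configuration has a balanced one close by -/
lemma exists_bal {n : ℕ} (hn : Even n) (y : Fin n → Bool) :
    ∃ b : Fin n → Bool, balanced b ∧ mag (bm y b) = n - |mag y| := by
  obtain ⟨m, hm⟩ := hn
  set T := Finset.univ.filter fun i => y i = true with hT
  have hmag : mag y = 2 * (T.card : ℝ) - n := by
    have : ∀ i, spin (y i) = 2 * (if y i = true then 1 else 0) - 1 := by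
      intro i; cases y i <;> norm_num [spin]
    unfold mag
    simp_rw [this]
    rw [Finset.sum_sub_distrib, ← Finset.mul_sum]
    simp [hT]
  have hmR : (n : ℝ) = 2 * m := by rw [hm]; push_cast; ring
  have key : ∀ S : Finset (Fin n), S.card = m →
      balanced (fun i => decide (i ∈ S)) := by
    intro S hS
    unfold balanced
    simp [hS]; omega
  rcases le_total m T.card with h | h
  · obtain ⟨S, hST, hS⟩ := Finset.exists_subset_card_eq h
    refine ⟨_, key S hS, ?_⟩
    rw [abs_of_nonneg (by rw [hmag, hmR]; have : (m:ℝ) ≤ T.card := by exact_mod_cast h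
                          linarith)]
    have e : ∀ i, spin (bm y (fun i => decide (i ∈ S)) i)
        = 1 - 2 * ((if i ∈ T then 1 else 0) - (if i ∈ S then 1 else 0)) := by
      intro i
      have h1 : i ∈ T ↔ y i = true := by simp [hT]
      by_cases h2 : i ∈ S
      · have := h1.1 (hST h2)
        simp [bm, this, h2, hST h2, spin]
      · by_cases h3 : i ∈ T
        · simp [bm, h1.1 h3, h2, h3, spin]; norm_num
        · have : y i = false := by simpa using (not_congr h1).1 h3
          simp [bm, this, h2, h3, spin]
    unfold mag at hmag ⊢
    rw [hmag, Finset.sum_congr rfl fun i _ => e i, Finset.sum_sub_distrib, ← Finset.mul_sum,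
      Finset.sum_sub_distrib]
    simp [hS]
    linarith
  · obtain ⟨S, hST, -, hS⟩ := Finset.exists_subsuperset_card_eq (Finset.subset_univ T) h
      (by simp; omega)
    refine ⟨_, key S hS, ?_⟩
    rw [abs_of_nonpos (by rw [hmag, hmR]; have : (T.card:ℝ) ≤ m := by exact_mod_cast h
                          linarith)]
    have e : ∀ i, spin (bm y (fun i => decide (i ∈ S)) i)
        = 1 - 2 * ((if i ∈ S then 1 else 0) - (if i ∈ T then 1 else 0)) := by
      intro i
      have h1 : i ∈ T ↔ y i = true := by simp [hT]
      by_cases h3 : i ∈ T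
      · have := hST h3
        simp [bm, h1.1 h3, this, h3, spin]
      · have h4 : y i = false := by simpa using (not_congr h1).1 h3
        by_cases h2 : i ∈ S
        · simp [bm, h4, h2, h3, spin]; norm_num
        · simp [bm, h4, h2, h3, spin]
    unfold mag at hmag ⊢
    rw [hmag, Finset.sum_congr rfl fun i _ => e i, Finset.sum_sub_distrib, ← Finset.mul_sum,
      Finset.sum_sub_distrib]
    simp [hS]
    linarith

lemma balanced_comp {n : ℕ} (b : Fin n → Bool) (hb : balanced b) (π : Equiv.Perm (Fin n)) :
    balanced (fun i => b (π i)) := by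
  unfold balanced at *
  refine Eq.trans ?_ hb
  congr 1
  refine Finset.card_bij (fun i _ => π i) (by simp) (by simp) ?_
  intro j hj
  exact ⟨π.symm j, by simpa using hj, by simp⟩

/-- two-point function averaged over permutations -/
noncomputable def cc {n : ℕ} (z : Fin n → Bool) : ℝ := ((mag z)^2 - n) / (n * (n - 1))

lemma perm_const {n : ℕ} (a : Fin n → ℝ) (i j i' j' : Fin n) (h : i ≠ j) (h' : i' ≠ j') :
    ∑ π : Equiv.Perm (Fin n), a (π i) * a (π j) = ∑ π : Equiv.Perm (Fin n), a (π i') * a (π j') := by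
  have step : ∀ i j j' : Fin n, i ≠ j → i ≠ j' →
      ∑ π : Equiv.Perm (Fin n), a (π i) * a (π j)
        = ∑ π : Equiv.Perm (Fin n), a (π i) * a (π j') := by
    intro i j j' h h'
    rw [← Equiv.sum_comp (Equiv.mulRight (Equiv.swap j j'))]
    refine Finset.sum_congr rfl fun π _ => ?_
    simp [Equiv.swap_apply_of_ne_of_ne h h']
  have symm : ∀ i j : Fin n, ∑ π : Equiv.Perm (Fin n), a (π i) * a (π j)
        = ∑ π : Equiv.Perm (Fin n), a (π j) * a (π i) :=
    fun i j => Finset.sum_congr rfl fun π _ => mul_comm _ _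
  by_cases h1 : i = j'
  · subst h1
    rw [step i j i' h h'.symm, symm]
  · rw [step i j j' h h1, symm, step j' i i' (Ne.symm h1) h'.symm, symm]

lemma perm_avg {n : ℕ} (hn : 2 ≤ n) (z : Fin n → Bool) (i j : Fin n) :
    ∑ π : Equiv.Perm (Fin n), spin (z (π i)) * spin (z (π j))
      = (n.factorial : ℝ) * (cc z + (1 - cc z) * (if i = j then 1 else 0)) := by
  by_cases hij : i = j
  · subst hij
    simp [spin_sq, Fintype.card_perm]
  · simp only [hij, if_false, mul_zero, add_zero]
    set f := ∑ π : Equiv.Perm (Fin n), spin (z (π i)) * spin (z (π j)) with hf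
    have tot : ∑ k : Fin n, ∑ l : Fin n,
        ∑ π : Equiv.Perm (Fin n), spin (z (π k)) * spin (z (π l))
        = (n.factorial : ℝ) * (mag z)^2 := by
      have : ∀ π : Equiv.Perm (Fin n),
          ∑ k : Fin n, ∑ l : Fin n, spin (z (π k)) * spin (z (π l)) = (mag z)^2 := by
        intro π
        rw [← Finset.sum_mul_sum, Equiv.sum_comp π (fun k => spin (z k)), sq, mag]
      simp_rw [Finset.sum_comm (s := (Finset.univ : Finset (Fin n)))
        (t := (Finset.univ : Finset (Equiv.Perm (Fin n))))]
      rw [Finset.sum_congr rfl fun π _ => this π]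
      simp [Fintype.card_perm]
    have each : ∀ k l : Fin n, ∑ π : Equiv.Perm (Fin n), spin (z (π k)) * spin (z (π l))
        = f + (n.factorial - f) * (if k = l then 1 else 0) := by
      intro k l
      by_cases hkl : k = l
      · subst hkl
        simp [spin_sq, Fintype.card_perm]
      · simp only [hkl, if_false, mul_zero, add_zero]
        exact perm_const (fun i => spin (z i)) k l i j hkl hij
    simp_rw [each] at tot
    simp [Finset.sum_add_distrib] at tot
    have h1 : (2:ℝ) ≤ n := by exact_mod_cast hn
    unfold cc
    have : (n:ℝ) * (n-1) ≠ 0 := by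
      apply ne_of_gt; apply mul_pos <;> linarith
    rw [← mul_div_assoc, eq_div_iff this]
    linarith

/-- trace part -/
noncomputable def dg (n : ℕ) (J : Fin n × Fin n → ℝ) : ℝ :=
  -(Real.sqrt (2 * n))⁻¹ * ∑ i : Fin n, J (i, i)

lemma perm_HSK {n : ℕ} (hn : 2 ≤ n) (J : Fin n × Fin n → ℝ) (x z : Fin n → Bool) :
    ∑ π : Equiv.Perm (Fin n), HSK n J (bm x (fun i => z (π i)))
      = (n.factorial : ℝ) * (cc z * HSK n J x + (1 - cc z) * dg n J) := by
  have hd : ∑ i : Fin n, J (i, i) = ∑ p : Fin n × Fin n,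
      (J p * spin (x p.1) * spin (x p.2)) * (if p.1 = p.2 then 1 else 0) := by
    rw [Fintype.sum_prod_type]
    refine Finset.sum_congr rfl fun i _ => ?_
    simp [mul_assoc, spin_sq]
  unfold HSK dg
  rw [hd, ← Finset.mul_sum, Finset.sum_comm]
  have : ∀ p : Fin n × Fin n, ∑ π : Equiv.Perm (Fin n),
      J p * spin (bm x (fun i => z (π i)) p.1) * spin (bm x (fun i => z (π i)) p.2)
      = (n.factorial : ℝ) * cc z * (J p * spin (x p.1) * spin (x p.2)) +
        (n.factorial : ℝ) * (1 - cc z) *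
          ((J p * spin (x p.1) * spin (x p.2)) * (if p.1 = p.2 then 1 else 0)) := by
    intro p
    have := perm_avg hn z p.1 p.2
    calc _ = ∑ π : Equiv.Perm (Fin n), (J p * spin (x p.1) * spin (x p.2)) *
          (spin (z (π p.1)) * spin (z (π p.2))) := by
          refine Finset.sum_congr rfl fun π _ => ?_
          simp only [bm, spin_beq]; ring
      _ = _ := by rw [← Finset.mul_sum, this]; ring
  rw [Finset.sum_congr rfl fun p _ => this p, Finset.sum_add_distrib, ← Finset.mul_sum,
    ← Finset.mul_sum]
  ring

lemma pointwise {n : ℕ} (hn : 2 ≤ n) (B : (Fin n → Bool) → (Fin n → Bool))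
    (hB : ∀ y, balanced (B y)) (J : Fin n × Fin n → ℝ) :
    ∑ τ : Fin n → Bool, USKconstr n (gauge τ J) ≤
      ∑ y : Fin n → Bool, (cc (bm y (B y)) * USKfree n J + (1 - cc (bm y (B y))) * dg n J) := by
  obtain ⟨x, hx⟩ := exists_free J
  have h1 : ∀ π : Equiv.Perm (Fin n), ∑ τ : Fin n → Bool, USKconstr n (gauge τ J) ≤
      ∑ y : Fin n → Bool, HSK n J (bm x (fun i => bm y (B y) (π i))) := by
    intro π
    let e1 : (Fin n → Bool) ≃ (Fin n → Bool) := ⟨bm x, bm x, bm_bm x, bm_bm x⟩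
    let e2 : (Fin n → Bool) ≃ (Fin n → Bool) :=
      ⟨fun y i => y (π i), fun y i => y (π.symm i), fun y => by simp, fun y => by simp⟩
    rw [← Equiv.sum_comp e1, ← Equiv.sum_comp e2]
    refine Finset.sum_le_sum fun y _ => ?_
    refine (constr_le _ (balanced_comp _ (hB y) π) _).trans (le_of_eq ?_)
    rw [HSK_gauge]
    congr 1
    funext i
    simp only [bm, e1, e2, Equiv.coe_fn_mk]
    cases x i <;> cases y (π i) <;> cases B y (π i) <;> rfl
  have h2 := Finset.sum_le_sum fun π (_ : π ∈ (Finset.univ : Finset (Equiv.Perm (Fin n)))) => h1 π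
  have h3 : ∑ π : Equiv.Perm (Fin n), ∑ y : Fin n → Bool,
      HSK n J (bm x (fun i => bm y (B y) (π i))) = ∑ y : Fin n → Bool, (n.factorial : ℝ) *
        (cc (bm y (B y)) * USKfree n J + (1 - cc (bm y (B y))) * dg n J) := by
    rw [Finset.sum_comm]
    refine Finset.sum_congr rfl fun y _ => ?_
    rw [perm_HSK hn, hx]
  rw [h3] at h2
  rw [← Finset.mul_sum, Finset.sum_const, Finset.card_univ, Fintype.card_perm, Fintype.card_fin,
    nsmul_eq_mul] at h2
  exact le_of_mul_le_mul_left h2 (by exact_mod_cast n.factorial_pos)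

lemma sum_mag_sq (n : ℕ) : ∑ y : Fin n → Bool, (mag y)^2 = 2^n * (n:ℝ) := by
  have hoff : ∀ i j : Fin n, ∑ y : Fin n → Bool, spin (y i) * spin (y j)
      = 2^n * (if i = j then 1 else 0) := by
    intro i j
    by_cases h : i = j
    · subst h; simp [spin_sq]
    · simp only [h, if_false, mul_zero]
      let e : (Fin n → Bool) ≃ (Fin n → Bool) :=
        ⟨bm (fun k => !decide (k = i)), bm (fun k => !decide (k = i)), bm_bm _, bm_bm _⟩
      have := Equiv.sum_comp e (fun y => spin (y i) * spin (y j))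
      have h2 : ∀ y, spin (e y i) * spin (e y j) = - (spin (y i) * spin (y j)) := by
        intro y
        simp only [e, Equiv.coe_fn_mk, bm, spin_beq]
        simp [Ne.symm h, spin]
        cases y i <;> cases y j <;> simp
      rw [Finset.sum_congr rfl fun y _ => h2 y, Finset.sum_neg_distrib] at this
      linarith
  have : ∀ y : Fin n → Bool, (mag y)^2 = ∑ i, ∑ j, spin (y i) * spin (y j) := by
    intro y; rw [sq, mag, Finset.sum_mul_sum]
  simp_rw [this]
  rw [Finset.sum_comm]
  simp_rw [Finset.sum_comm (s := (Finset.univ : Finset (Fin n → Bool))), hoff]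
  simp [mul_comm]

lemma main_bound {n : ℕ} (hn : 2 ≤ n) (he : Even n) :
    ∃ C : ℝ, 0 ≤ 1 - C ∧ 1 - C ≤ 2 * Real.sqrt n / (n - 1) ∧
      ∫ J, USKconstr n J ∂(skMeasure n) ≤ C * ∫ J, USKfree n J ∂(skMeasure n) := by
  choose B hB hmag using exists_bal he
  have hex : ∃ σ : Fin n → Bool, balanced σ := ⟨_, hB fun _ => true⟩
  have hn' : (2:ℝ) ≤ n := by exact_mod_cast hn
  have h2 : (0:ℝ) < 2^n := by positivity
  set S := ∑ y : Fin n → Bool, cc (bm y (B y)) with hS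
  have hS1 : 2^n - S = ∑ y : Fin n → Bool, (1 - cc (bm y (B y))) := by
    rw [Finset.sum_sub_distrib]; simp [hS]
  have habs : ∀ y : Fin n → Bool, |mag y| ≤ n := by
    intro y
    refine (Finset.abs_sum_le_sum_abs _ _).trans ?_
    have : ∀ i, |spin (y i)| = 1 := by intro i; cases y i <;> simp [spin]
    simp [this]
  have hpos : 0 < (n:ℝ) * (n-1) := by apply mul_pos <;> linarith
  have hcc : ∀ y : Fin n → Bool, 1 - cc (bm y (B y)) =
      (n^2 - (n - |mag y|)^2) / (n * (n-1)) := by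
    intro y
    unfold cc
    rw [hmag, eq_div_iff hpos.ne', sub_mul, div_mul_cancel₀ _ hpos.ne']
    ring
  have hlow : 0 ≤ 2^n - S := by
    rw [hS1]
    refine Finset.sum_nonneg fun y _ => ?_
    rw [hcc]
    refine div_nonneg ?_ hpos.le
    nlinarith [habs y, abs_nonneg (mag y)]
  have hup : 2^n - S ≤ 2^n * (2 * Real.sqrt n / (n - 1)) := by
    rw [hS1]
    have hs : 0 < Real.sqrt n := Real.sqrt_pos.2 (by linarith)
    have hss : Real.sqrt n * Real.sqrt n = n := Real.mul_self_sqrt (by linarith)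
    have : ∀ y : Fin n → Bool, 1 - cc (bm y (B y)) ≤
        ((mag y)^2 / Real.sqrt n + Real.sqrt n) / (n - 1) := by
      intro y
      rw [hcc]
      have hle : 2 * |mag y| ≤ (mag y)^2 / Real.sqrt n + Real.sqrt n := by
        rw [← sub_nonneg]
        have : (mag y)^2 / Real.sqrt n + Real.sqrt n - 2 * |mag y|
            = (|mag y| - Real.sqrt n)^2 / Real.sqrt n := by
          rw [← sq_abs (mag y)]; field_simp; ring
        rw [this]; positivity
      rw [div_le_div_iff₀ hpos (by linarith)]
      have h3 : (n:ℝ)^2 - (n - |mag y|)^2 ≤ n * (2 * |mag y|) := by nlinarith [sq_nonneg |mag y|]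
      have h4 := mul_le_mul_of_nonneg_left hle (by linarith : (0:ℝ) ≤ n)
      have h5 := mul_le_mul_of_nonneg_right (h3.trans h4) (by linarith : (0:ℝ) ≤ n - 1)
      linarith
    refine (Finset.sum_le_sum fun y _ => this y).trans (le_of_eq ?_)
    rw [← Finset.sum_div, Finset.sum_add_distrib, ← Finset.sum_div, sum_mag_sq]
    have h6 : (2:ℝ)^n * n / Real.sqrt n = 2^n * Real.sqrt n := by
      rw [div_eq_iff hs.ne', mul_assoc, hss]
    rw [h6]
    simp
    ring
  refine ⟨S / 2^n, ?_, ?_, ?_⟩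
  · rw [sub_nonneg, div_le_one h2]; linarith
  · have : 1 - S / 2^n = (2^n - S) / 2^n := by field_simp
    rw [this, div_le_iff₀ h2]; linarith
  · have hdg : Integrable (dg n) (skMeasure n) := by
      unfold dg
      exact Integrable.const_mul (integrable_finsetSum _ fun p _ => int_eval _) _
    have hdg0 : ∫ J, dg n J ∂(skMeasure n) = 0 := by
      unfold dg
      rw [integral_const_mul, integral_finsetSum _ fun p _ => int_eval _]
      simp [integral_eval]
    have hg : ∀ τ : Fin n → Bool, Integrable (fun J => USKconstr n (gauge τ J)) (skMeasure n) :=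
      fun τ => (mp_gauge τ).integrable_comp_of_integrable (int_constr n hex)
    have hmono := integral_mono (μ := skMeasure n)
      (f := fun J => ∑ τ : Fin n → Bool, USKconstr n (gauge τ J))
      (g := fun J => S * USKfree n J + (2^n - S) * dg n J)
      (integrable_finsetSum _ fun τ _ => hg τ)
      (((int_free n).const_mul _).add (hdg.const_mul _))
      (fun J => by
        refine (pointwise hn B hB J).trans (le_of_eq ?_)
        rw [Finset.sum_add_distrib, ← Finset.sum_mul, ← Finset.sum_mul, hS1])
    rw [integral_finsetSum _ fun τ _ => hg τ,
      integral_add ((int_free n).const_mul _) (hdg.const_mul _), integral_const_mul,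
      integral_const_mul, hdg0, Finset.sum_congr rfl fun τ _ => integral_gauge hex τ] at hmono
    simp at hmono
    rw [div_mul_eq_mul_div, le_div_iff₀ h2]
    linarith

end SKaux

/-- **Limit of the constrained SK ground-state energy density**: if `P_*` is
the limit of `n⁻¹ E[max_{σ∈{−1,+1}^n}(−H^SK_n(σ))]` (which exists by the Parisi
formula) then, as `n → ∞` along even `n`,
`n⁻¹ E[min_{σ∈Ω_n} H^SK_n(σ)] → −P_*`; in particular the constrained and
unconstrained ground-state energy densities have the same limit. -/
theorem constrained_SK_ground_state_limit
    (Pstar : ℝ)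
    (hP : Tendsto (fun n : ℕ =>
        (n : ℝ)⁻¹ * ∫ J, (⨆ σ : Fin n → Bool, -HSK n J σ) ∂(skMeasure n))
      atTop (nhds Pstar)) :
    Tendsto (fun n : ℕ => (n : ℝ)⁻¹ * ∫ J, USKconstr n J ∂(skMeasure n))
      (atTop ⊓ Filter.principal {n : ℕ | Even n}) (nhds (-Pstar))
    ∧ Tendsto (fun n : ℕ =>
        (n : ℝ)⁻¹ * ((∫ J, USKconstr n J ∂(skMeasure n))
          - ∫ J, USKfree n J ∂(skMeasure n)))
      (atTop ⊓ Filter.principal {n : ℕ | Even n}) (nhds 0) := by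
  have hfree : ∀ n : ℕ, ∫ J, (⨆ σ : Fin n → Bool, -HSK n J σ) ∂(skMeasure n)
      = - ∫ J, USKfree n J ∂(skMeasure n) := by
    intro n
    simp_rw [SKaux.free_eq_neg_sup]
    rw [integral_neg]
  have hF : Tendsto (fun n : ℕ => (n : ℝ)⁻¹ * ∫ J, USKfree n J ∂(skMeasure n))
      (atTop ⊓ Filter.principal {n : ℕ | Even n}) (nhds (-Pstar)) := by
    have := hP.neg.mono_left (inf_le_left (b := Filter.principal {n : ℕ | Even n}))
    refine this.congr fun n => ?_
    rw [hfree]; ring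
  have hrate : Tendsto (fun n : ℕ => 2 * Real.sqrt n / ((n:ℝ) - 1))
      (atTop ⊓ Filter.principal {n : ℕ | Even n}) (nhds 0) := by
    refine Tendsto.mono_left ?_ inf_le_left
    have h1 : Tendsto (fun n : ℕ => 4 / Real.sqrt n) atTop (nhds 0) :=
      Tendsto.const_div_atTop
        (Real.tendsto_sqrt_atTop.comp tendsto_natCast_atTop_atTop) 4
    refine squeeze_zero' ?_ ?_ h1
    · filter_upwards [eventually_ge_atTop 2] with n hn
      have : (2:ℝ) ≤ n := by exact_mod_cast hn
      exact div_nonneg (by positivity) (by linarith)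
    · filter_upwards [eventually_ge_atTop 2] with n hn
      have : (2:ℝ) ≤ n := by exact_mod_cast hn
      have hss : Real.sqrt n * Real.sqrt n = n := Real.mul_self_sqrt (by linarith)
      rw [div_le_div_iff₀ (by linarith) (Real.sqrt_pos.2 (by linarith))]
      nlinarith
  have hD : Tendsto (fun n : ℕ =>
        (n : ℝ)⁻¹ * ((∫ J, USKconstr n J ∂(skMeasure n))
          - ∫ J, USKfree n J ∂(skMeasure n)))
      (atTop ⊓ Filter.principal {n : ℕ | Even n}) (nhds 0) := by
    have hub : Tendsto (fun n : ℕ => 2 * Real.sqrt n / ((n:ℝ) - 1) *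
        |(n : ℝ)⁻¹ * ∫ J, USKfree n J ∂(skMeasure n)|)
        (atTop ⊓ Filter.principal {n : ℕ | Even n}) (nhds 0) := by
      simpa using hrate.mul hF.abs
    have hev : ∀ᶠ n : ℕ in atTop ⊓ Filter.principal {n : ℕ | Even n}, 2 ≤ n ∧ Even n := by
      rw [eventually_inf_principal]
      filter_upwards [eventually_ge_atTop 2] with n hn he using ⟨hn, he⟩
    refine squeeze_zero' ?_ ?_ hub
    · filter_upwards [hev] with n hn
      obtain ⟨b, hb, -⟩ := SKaux.exists_bal hn.2 (fun _ => true)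
      refine mul_nonneg (by positivity) (sub_nonneg.2 ?_)
      exact integral_mono (SKaux.int_free n) (SKaux.int_constr n ⟨b, hb⟩) (SKaux.free_le_constr ⟨b, hb⟩)
    · filter_upwards [hev] with n hn
      obtain ⟨C, hC0, hC1, hC⟩ := SKaux.main_bound hn.1 hn.2
      have hinv : (0:ℝ) ≤ (n:ℝ)⁻¹ := by positivity
      calc _ ≤ (n : ℝ)⁻¹ * (C * (∫ J, USKfree n J ∂(skMeasure n))
          - ∫ J, USKfree n J ∂(skMeasure n)) := by gcongr
        _ = (1 - C) * (-((n : ℝ)⁻¹ * ∫ J, USKfree n J ∂(skMeasure n))) := by ring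
        _ ≤ (1 - C) * |(n : ℝ)⁻¹ * ∫ J, USKfree n J ∂(skMeasure n)| := by
          gcongr; exact neg_le_abs _
        _ ≤ _ := by gcongr
  refine ⟨?_, hD⟩
  have := hD.add hF
  rw [zero_add] at this
  refine this.congr fun n => ?_
  ring
end
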